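/- For every β ∈ [2,∞) there exist C_β > 0 and λ₀ ∈ (0,1/2) such that for all λ ∈ (0,λ₀) and all integers N ≥ 2, log 𝔼_{ℙ_{N,β}^λ}[ exp( β ( F_λ − F̃_λ ) ) ] ≤ C_β (N ω_λ + log N), where F̃_λ(Z_{2N}) = −(1/2) Σ_{i=1}^{2N} g_λ(z_i − z_{φ₁(i)}) · 1[ φ₁(φ₁(i)) = i and d_i d_{φ₁(i)} = −1 ] (defined for almost every configuration). -/

import Mathlib

open MeasureTheory Real
open scoped ENNReal NNReal BigOperators Classical

noncomputable section

/-- The plane `ℝ²`. -/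
abbrev E2 := EuclideanSpace ℝ (Fin 2)

/-- The logarithmic Coulomb kernel `g(x) = -log |x|`. -/
def gfun (x : E2) : ℝ := -Real.log ‖x‖

/-- The uniform probability measure on the closed ball `B(z, lam)` (smeared charge). -/
def udisc (z : E2) (lam : ℝ) : MeasureTheory.Measure E2 :=
  (MeasureTheory.volume (Metric.closedBall z lam))⁻¹ •
    MeasureTheory.volume.restrict (Metric.closedBall z lam)

/-- The smeared interaction `g_lam(z) = ∬ g(x-y) dδ_0^{(lam)}(x) dδ_z^{(lam)}(y)`. -/
def gsm (lam : ℝ) (z : E2) : ℝ :=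
  ∫ x, (∫ y, gfun (x - y) ∂(udisc z lam)) ∂(udisc 0 lam)

/-- `κ = g_1(0)`. -/
def kappa : ℝ := gsm 1 0

/-- The (renormalized) energy `F_lam(X_N, Y_N)`. -/
def Flam (N : ℕ) (lam : ℝ) (X Y : Fin N → E2) : ℝ :=
  (1/2) * (∑ i : Fin N, ∑ j : Fin N,
      (gsm lam (X i - X j) + gsm lam (Y i - Y j) - 2 * gsm lam (X i - Y j)))
    - N * (-Real.log lam + kappa)

/-- The box `Λ = [0, √N]²`. -/
def LamBox (N : ℕ) : Set E2 := {x | ∀ i, x i ∈ Set.Icc (0:ℝ) (Real.sqrt N)}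

/-- The configuration space `Λ^N × Λ^N`. -/
def confSet (N : ℕ) : Set ((Fin N → E2) × (Fin N → E2)) :=
  {P | (∀ i, P.1 i ∈ LamBox N) ∧ (∀ i, P.2 i ∈ LamBox N)}

/-- The partition function `Z_{N,β}^{lam}`. -/
def Zpart (N : ℕ) (β lam : ℝ) : ℝ :=
  ∫ P in confSet N, Real.exp (-β * Flam N lam P.1 P.2)

/-- `g_1` evaluated at (any) point of norm `r` (it is radial). -/
def g1rad (r : ℝ) : ℝ := gsm 1 (EuclideanSpace.single (0 : Fin 2) r)

/-- The constant `𝒵_β`. -/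
def Zbeta (β : ℝ) : ℝ :=
  if β = 2 then 2 * Real.pi
  else 2 * Real.pi * ∫ r in Set.Ioi (0:ℝ), Real.exp (β * g1rad r) * r

/-- The error rate `ω_lam` (with `M₀ = 36`). -/
def omegaL (β lam : ℝ) : ℝ :=
  if β = 2 then |Real.log lam| ^ (-(1:ℝ)/(5+36))
  else if β < 4 then lam ^ ((2*(β-2))/(12-β+36))
  else if β = 4 then (lam * |Real.log lam|) ^ ((1:ℝ)/(2+36))
  else lam ^ ((1:ℝ)/(2+36))

/-- Nearest-neighbor index: the unique `j ≠ i` minimizing `|z_i - z_j|` when it exists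
(this is the case almost everywhere), and `i` otherwise. -/
def phi1 {ι : Type} [Fintype ι] (z : ι → E2) (i : ι) : ι :=
  if h : ∃! j, j ≠ i ∧ ∀ k, k ≠ i → dist (z i) (z j) ≤ dist (z i) (z k) then h.choose else i

/-- The charge `d_i`: `+1` for the `x`-indices and `-1` for the `y`-indices. -/
def charge {N : ℕ} : Fin N ⊕ Fin N → ℝ := Sum.elim (fun _ => 1) (fun _ => -1)

/-- The combined configuration `(z_1, …, z_{2N}) = (x_1, …, x_N, y_1, …, y_N)`. -/
def zconf {N : ℕ} (X Y : Fin N → E2) : Fin N ⊕ Fin N → E2 := Sum.elim X Y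

/-- The reduced nearest-neighbor dipole energy `F̃_lam`. -/
def Ftil (N : ℕ) (lam : ℝ) (X Y : Fin N → E2) : ℝ :=
  -(1/2) * ∑ i : Fin N ⊕ Fin N,
    (if phi1 (zconf X Y) (phi1 (zconf X Y) i) = i ∧
        charge i * charge (phi1 (zconf X Y) i) = -1
     then gsm lam (zconf X Y i - zconf X Y (phi1 (zconf X Y) i)) else 0)

/-- The Gibbs measure `ℙ_{N,β}^{lam}` on `Λ^N × Λ^N`. -/
def Gibbs (N : ℕ) (β lam : ℝ) : MeasureTheory.Measure ((Fin N → E2) × (Fin N → E2)) :=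
  (ENNReal.ofReal (Zpart N β lam))⁻¹ •
    ((MeasureTheory.volume.restrict (confSet N)).withDensity
      (fun P => ENNReal.ofReal (Real.exp (-β * Flam N lam P.1 P.2))))

/-! ### The smeared kernel -/

/-- The positive part of the logarithmic kernel. -/
def gpos (u : E2) : ℝ := max 0 (-Real.log ‖u‖)

/-- The uniform measure on the unit disc. -/
abbrev unu : Measure E2 := udisc 0 1

/-- The potential generated by the unit disc. -/
def discPot (v : E2) : ℝ := ∫ y, gfun (v - y) ∂unu

lemma measurable_gfun : Measurable gfun := by
  unfold gfun; fun_prop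

lemma volume_closedBall_E2 (x : E2) (r : ℝ) :
    volume (Metric.closedBall x r) = ENNReal.ofReal r ^ 2 * ENNReal.ofReal Real.pi :=
  EuclideanSpace.volume_closedBall_fin_two x r

lemma integrable_gpos : Integrable gpos := by
  have h := (integrable_fun_norm_addHaar (E := E2) (volume : Measure E2)
    (f := fun r : ℝ => max 0 (-Real.log r))).2
  refine h ?_
  have hd : Module.finrank ℝ E2 = 2 := by simp
  rw [hd]
  have h1 : IntegrableOn (fun y : ℝ => y ^ (2 - 1) • max 0 (-Real.log y)) (Set.Ioc 0 1) := by
    refine Measure.integrableOn_of_bounded (M := 1) (by simp) ?_ ?_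
    · exact Measurable.aestronglyMeasurable (by fun_prop)
    · refine (ae_restrict_iff' measurableSet_Ioc).2 (Filter.Eventually.of_forall ?_)
      intro y hy
      have hy0 : 0 < y := hy.1
      have hl : -Real.log y ≤ y⁻¹ - 1 := by
        have := Real.log_le_sub_one_of_pos (inv_pos.2 hy0)
        rwa [Real.log_inv] at this
      have hl0 : 0 ≤ -Real.log y := by
        have := Real.log_nonpos hy0.le hy.2
        linarith
      rw [max_eq_right hl0]
      simp only [Nat.add_one_sub_one, pow_one, smul_eq_mul]
      rw [Real.norm_of_nonneg (mul_nonneg hy0.le hl0)]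
      calc y * -Real.log y ≤ y * (y⁻¹ - 1) := by gcongr
        _ = 1 - y := by field_simp
        _ ≤ 1 := by linarith
  refine h1.of_forall_sdiff_eq_zero measurableSet_Ioi ?_
  intro y hy
  have hy1 : 1 < y := by
    by_contra hc
    exact hy.2 ⟨hy.1, not_lt.1 hc⟩
  have : -Real.log y ≤ 0 := by
    have := Real.log_nonneg hy1.le
    linarith
  simp [max_eq_left this]

lemma udisc_isProbabilityMeasure (z : E2) {lam : ℝ} (h : 0 < lam) :
    IsProbabilityMeasure (udisc z lam) := by
  constructor
  unfold udisc
  rw [Measure.smul_apply, Measure.restrict_apply_univ, smul_eq_mul]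
  refine ENNReal.inv_mul_cancel ?_ ?_
  · exact (Metric.measure_closedBall_pos volume z h).ne'
  · exact measure_closedBall_lt_top.ne

instance unu_prob : IsProbabilityMeasure unu := udisc_isProbabilityMeasure 0 one_pos

lemma integral_udisc (z : E2) {lam : ℝ} (h : 0 < lam) (f : E2 → ℝ) :
    ∫ y, f y ∂(udisc z lam) = ∫ y, f (z + lam • y) ∂unu := by
  have key : ∫ y in Metric.closedBall z lam, f y
      = lam ^ 2 * ∫ y in Metric.closedBall (0 : E2) 1, f (z + lam • y) := by
    have h1 := Measure.setIntegral_comp_smul_of_pos (volume : Measure E2)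
      (fun y => f (z + y)) (Metric.closedBall (0 : E2) 1) h
    have hd : Module.finrank ℝ E2 = 2 := by simp
    rw [hd] at h1
    rw [h1, smul_eq_mul, smul_unitClosedBall_of_nonneg h.le]
    have h2 := (measurePreserving_add_left (volume : Measure E2) z).setIntegral_preimage_emb
      (MeasurableEquiv.addLeft z).measurableEmbedding f (Metric.closedBall z lam)
    have h3 : (fun x => z + x) ⁻¹' Metric.closedBall z lam = Metric.closedBall 0 lam := by
      ext y; simp [Metric.mem_closedBall, dist_eq_norm]
    rw [h3] at h2
    rw [h2]
    field_simp
  unfold unu udisc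
  rw [integral_smul_measure, integral_smul_measure, key, volume_closedBall_E2,
    volume_closedBall_E2]
  simp only [smul_eq_mul, ENNReal.toReal_inv, ENNReal.toReal_mul, ENNReal.toReal_pow,
    ENNReal.toReal_ofReal h.le, ENNReal.toReal_ofReal Real.pi_pos.le,
    ENNReal.toReal_ofReal zero_le_one]
  field_simp

lemma unu_le : unu ≤ (ENNReal.ofReal Real.pi)⁻¹ • (volume : Measure E2) := by
  unfold unu udisc
  rw [volume_closedBall_E2]
  simp only [ENNReal.ofReal_one, one_pow, one_mul]
  exact smul_le_smul_left _ Measure.restrict_le_self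

lemma integrable_gpos_unu (v : E2) : Integrable (fun y => gpos (v - y)) unu := by
  have h : Integrable (fun y => gpos (v - y)) :=
    integrable_gpos.comp_sub_left v
  refine (h.smul_measure (c := (ENNReal.ofReal Real.pi)⁻¹) ?_).mono_measure unu_le
  simp [Real.pi_pos]

/-- An upper bound for the potential of the unit disc. -/
def Kpot : ℝ := Real.pi⁻¹ * ∫ u, gpos u

lemma Kpot_nonneg : 0 ≤ Kpot := by
  unfold Kpot
  have : 0 ≤ ∫ u, gpos u := integral_nonneg fun u => le_max_left _ _
  positivity

lemma integral_gpos_le (v : E2) : ∫ y, gpos (v - y) ∂unu ≤ Kpot := by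
  have h : Integrable (fun y => gpos (v - y)) :=
    integrable_gpos.comp_sub_left v
  have h2 := integral_mono_measure unu_le (f := fun y => gpos (v - y))
    (Filter.Eventually.of_forall fun y => le_max_left _ _)
    (h.smul_measure (c := (ENNReal.ofReal Real.pi)⁻¹) (by simp [Real.pi_pos]))
  refine h2.trans (le_of_eq ?_)
  rw [integral_smul_measure, integral_sub_left_eq_self gpos]
  simp [Kpot, Real.pi_pos.le]

lemma ae_unu_norm_le : ∀ᵐ y ∂unu, ‖y‖ ≤ 1 := by
  unfold unu udisc
  refine Measure.ae_smul_measure ?_ _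
  filter_upwards [ae_restrict_mem (Metric.isClosed_closedBall.measurableSet)] with y hy
  simpa using hy

lemma ae_unu_ne (v : E2) : ∀ᵐ y ∂unu, y ≠ v := by
  unfold unu udisc
  refine Measure.ae_smul_measure ?_ _
  refine ae_restrict_of_ae ?_
  exact Measure.ae_ne volume v

lemma gfun_le_gpos (u : E2) : gfun u ≤ gpos u := le_max_right _ _

lemma neg_log_le_gfun {u : E2} {a : ℝ} (ha : 1 ≤ a) (h : ‖u‖ ≤ a) :
    -Real.log a ≤ gfun u := by
  unfold gfun
  rcases (norm_nonneg u).eq_or_lt with h0 | h0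
  · rw [← h0]; simp; exact Real.log_nonneg ha
  · have := Real.log_le_log h0 h
    linarith

lemma ae_neg_log_le_gfun (v : E2) :
    ∀ᵐ y ∂unu, -Real.log (‖v‖ + 1) ≤ gfun (v - y) := by
  filter_upwards [ae_unu_norm_le] with y hy
  refine neg_log_le_gfun (by linarith [norm_nonneg v]) ?_
  exact (norm_sub_le v y).trans (by linarith)

lemma integrable_gfun_unu (v : E2) : Integrable (fun y => gfun (v - y)) unu := by
  have hm : Measurable fun y => gfun (v - y) := measurable_gfun.comp (by fun_prop)
  refine ((integrable_gpos_unu v).add (integrable_const (Real.log (‖v‖ + 1)))).mono'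
    hm.aestronglyMeasurable ?_
  filter_upwards [ae_neg_log_le_gfun v] with y hy
  have h0 : 0 ≤ Real.log (‖v‖ + 1) := Real.log_nonneg (by linarith [norm_nonneg v])
  have h1 : (0:ℝ) ≤ gpos (v - y) := le_max_left _ _
  have h2 := gfun_le_gpos (v - y)
  simp only [Pi.add_apply]
  rw [Real.norm_eq_abs, abs_le]
  constructor <;> linarith

lemma discPot_le (v : E2) : discPot v ≤ Kpot :=
  (integral_mono (integrable_gfun_unu v) (integrable_gpos_unu v)
    (fun _ => gfun_le_gpos _)).trans (integral_gpos_le v)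

lemma le_discPot (v : E2) : -Real.log (‖v‖ + 1) ≤ discPot v := by
  have := integral_mono_ae (integrable_const (-Real.log (‖v‖ + 1))) (integrable_gfun_unu v)
    (ae_neg_log_le_gfun v)
  simpa [discPot] using this

lemma discPot_le_of_one_lt {v : E2} (hv : 1 < ‖v‖) : discPot v ≤ -Real.log (‖v‖ - 1) := by
  have := integral_mono_ae (integrable_gfun_unu v) (integrable_const (-Real.log (‖v‖ - 1))) (by
    filter_upwards [ae_unu_norm_le] with y hy
    unfold gfun
    have h1 : ‖v‖ - 1 ≤ ‖v - y‖ := by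
      have := norm_sub_norm_le v y
      linarith
    have := Real.log_le_log (by linarith) h1
    linarith)
  simpa [discPot] using this

lemma measurable_discPot : Measurable discPot := by
  have : StronglyMeasurable (fun p : E2 × E2 => gfun (p.1 - p.2)) :=
    (measurable_gfun.comp (by fun_prop)).stronglyMeasurable
  exact this.integral_prod_right.measurable

/-- The unit-scale smeared kernel. -/
def hker (w : E2) : ℝ := ∫ x, discPot (x - w) ∂unu

lemma integrable_discPot (w : E2) : Integrable (fun x => discPot (x - w)) unu := by
  have hm : Measurable fun y => discPot (y - w) := measurable_discPot.comp (by fun_prop)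
  refine (integrable_const (Kpot + Real.log (‖w‖ + 2))).mono' hm.aestronglyMeasurable ?_
  filter_upwards [ae_unu_norm_le] with x hx
  have h0 : 0 ≤ Real.log (‖w‖ + 2) := Real.log_nonneg (by linarith [norm_nonneg w])
  have h1 := discPot_le (x - w)
  have h2 := le_discPot (x - w)
  have h3 : Real.log (‖x - w‖ + 1) ≤ Real.log (‖w‖ + 2) := by
    apply Real.log_le_log (by positivity)
    have := norm_sub_le x w
    linarith
  rw [Real.norm_eq_abs, abs_le]
  have := Kpot_nonneg
  constructor <;> linarith

lemma hker_le (w : E2) : hker w ≤ Kpot := by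
  have := integral_mono (integrable_discPot w) (integrable_const Kpot)
    (fun x => discPot_le (x - w))
  simpa [hker] using this

lemma le_hker (w : E2) : -Real.log (‖w‖ + 2) ≤ hker w := by
  have := integral_mono_ae (integrable_const (-Real.log (‖w‖ + 2))) (integrable_discPot w) (by
    filter_upwards [ae_unu_norm_le] with x hx
    have h2 := le_discPot (x - w)
    have h3 : Real.log (‖x - w‖ + 1) ≤ Real.log (‖w‖ + 2) := by
      apply Real.log_le_log (by positivity)
      have := norm_sub_le x w
      linarith
    linarith)
  simpa [hker] using this

lemma hker_le_of_two_lt {w : E2} (hw : 2 < ‖w‖) : hker w ≤ -Real.log (‖w‖ - 2) := by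
  have := integral_mono_ae (integrable_discPot w) (integrable_const (-Real.log (‖w‖ - 2))) (by
    filter_upwards [ae_unu_norm_le] with x hx
    have h1 : ‖w‖ - 1 ≤ ‖x - w‖ := by
      have := norm_sub_norm_le w x
      rw [norm_sub_rev] at this
      linarith
    have h2 := discPot_le_of_one_lt (v := x - w) (by linarith)
    have := Real.log_le_log (by linarith) (show ‖w‖ - 2 ≤ ‖x - w‖ - 1 by linarith)
    linarith)
  simpa [hker] using this

lemma measurable_hker : Measurable hker := by
  have : StronglyMeasurable (fun p : E2 × E2 => discPot (p.2 - p.1)) :=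
    (measurable_discPot.comp (by fun_prop)).stronglyMeasurable
  exact this.integral_prod_right.measurable

lemma integral_unu_neg (f : E2 → ℝ) : ∫ y, f (-y) ∂unu = ∫ y, f y ∂unu := by
  unfold unu udisc
  rw [integral_smul_measure, integral_smul_measure]
  congr 1
  have h2 := (Measure.measurePreserving_neg (volume : Measure E2)).setIntegral_preimage_emb
      (MeasurableEquiv.neg E2).measurableEmbedding f (Metric.closedBall 0 1)
  have h3 : Neg.neg ⁻¹' Metric.closedBall (0 : E2) 1 = Metric.closedBall 0 1 := by
    ext y; simp
  rwa [h3] at h2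

lemma discPot_neg (v : E2) : discPot (-v) = discPot v := by
  unfold discPot
  rw [← integral_unu_neg]
  congr 1; ext y
  unfold gfun
  rw [← norm_neg]; congr 3; abel

lemma hker_neg (w : E2) : hker (-w) = hker w := by
  unfold hker
  rw [← integral_unu_neg]
  congr 1; ext y
  rw [← discPot_neg]; congr 1; abel

lemma gsm_eq {lam : ℝ} (h : 0 < lam) (z : E2) :
    gsm lam z = -Real.log lam + hker (lam⁻¹ • z) := by
  unfold gsm
  simp only [integral_udisc z h]
  rw [integral_udisc 0 h]
  simp only [zero_add]
  have h1 : ∀ x : E2, ∫ y, gfun (lam • x - (z + lam • y)) ∂unu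
      = -Real.log lam + discPot (x - lam⁻¹ • z) := by
    intro x
    have h2 : ∀ᵐ y ∂unu, gfun (lam • x - (z + lam • y))
        = -Real.log lam + gfun ((x - lam⁻¹ • z) - y) := by
      filter_upwards [ae_unu_ne (x - lam⁻¹ • z)] with y hy
      have h3 : lam • x - (z + lam • y) = lam • ((x - lam⁻¹ • z) - y) := by
        rw [smul_sub, smul_sub, smul_inv_smul₀ h.ne']; abel
      rw [h3]
      unfold gfun
      rw [norm_smul, Real.log_mul (by simpa using h.ne')
        (by simpa [sub_eq_zero] using hy.symm), Real.norm_of_nonneg h.le]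
      ring
    rw [integral_congr_ae h2, integral_add (integrable_const _) (integrable_gfun_unu _)]
    simp [discPot]
  simp only [h1]
  rw [integral_add (integrable_const _) (integrable_discPot _)]
  simp [hker]

lemma gsm_neg {lam : ℝ} (h : 0 < lam) (z : E2) : gsm lam (-z) = gsm lam z := by
  rw [gsm_eq h, gsm_eq h, smul_neg, hker_neg]

lemma gsm_sub_comm {lam : ℝ} (h : 0 < lam) (x y : E2) : gsm lam (x - y) = gsm lam (y - x) := by
  rw [← gsm_neg h, neg_sub]

lemma gsm_zero {lam : ℝ} (h : 0 < lam) : gsm lam 0 = -Real.log lam + kappa := by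
  unfold kappa
  rw [gsm_eq h, gsm_eq one_pos]
  simp

lemma measurable_gsm {lam : ℝ} (h : 0 < lam) : Measurable (gsm lam) := by
  have : gsm lam = fun z => -Real.log lam + hker (lam⁻¹ • z) := funext (gsm_eq h)
  rw [this]
  exact (measurable_hker.comp (by fun_prop)).const_add _

lemma norm_inv_smul_E2 {lam : ℝ} (h : 0 < lam) (z : E2) : ‖lam⁻¹ • z‖ = ‖z‖ / lam := by
  rw [norm_smul, Real.norm_of_nonneg (inv_nonneg.2 h.le)]; ring

lemma gsm_le {lam : ℝ} (h : 0 < lam) (z : E2) : gsm lam z ≤ -Real.log lam + Kpot := by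
  rw [gsm_eq h]; linarith [hker_le (lam⁻¹ • z)]

lemma le_gsm {lam : ℝ} (h : 0 < lam) (z : E2) : -Real.log (‖z‖ + 2 * lam) ≤ gsm lam z := by
  rw [gsm_eq h]
  have h1 := le_hker (lam⁻¹ • z)
  rw [norm_inv_smul_E2 h] at h1
  have h2 : Real.log (‖z‖ + 2 * lam) = Real.log lam + Real.log (‖z‖ / lam + 2) := by
    rw [← Real.log_mul h.ne' (by positivity)]
    congr 1; field_simp
  linarith

lemma gsm_le_far {lam : ℝ} (h : 0 < lam) {z : E2} (hz : 2 * lam < ‖z‖) :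
    gsm lam z ≤ -Real.log (‖z‖ - 2 * lam) := by
  rw [gsm_eq h]
  have h0 : 2 < ‖z‖ / lam := by rwa [lt_div_iff₀ h]
  have h1 := hker_le_of_two_lt (w := lam⁻¹ • z) (by rwa [norm_inv_smul_E2 h])
  rw [norm_inv_smul_E2 h] at h1
  have h2 : Real.log (‖z‖ - 2 * lam) = Real.log lam + Real.log (‖z‖ / lam - 2) := by
    rw [← Real.log_mul h.ne' (by linarith)]
    congr 1; field_simp
  linarith

lemma gsm_le_neg_log {lam : ℝ} (h : 0 < lam) {z : E2} (hz : z ≠ 0) :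
    gsm lam z ≤ -Real.log ‖z‖ + (Kpot + Real.log 4) := by
  have hz0 : 0 < ‖z‖ := norm_pos_iff.2 hz
  have hK := Kpot_nonneg
  rcases le_or_gt (4 * lam) ‖z‖ with h4 | h4
  · have h1 := gsm_le_far h (z := z) (by linarith)
    have h2 : Real.log ‖z‖ ≤ Real.log 4 + Real.log (‖z‖ - 2 * lam) := by
      rw [← Real.log_mul (by norm_num) (by linarith)]
      exact Real.log_le_log hz0 (by linarith)
    linarith
  · have h1 := gsm_le h z
    have h2 : Real.log ‖z‖ ≤ Real.log 4 + Real.log lam := by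
      rw [← Real.log_mul (by norm_num) h.ne']
      exact Real.log_le_log hz0 h4.le
    linarith

lemma gsm_nonpos {lam : ℝ} (h : 0 < lam) (h2 : lam < 1 / 2) {z : E2} (hz : 2 ≤ ‖z‖) :
    gsm lam z ≤ 0 := by
  have h1 := gsm_le_far h (z := z) (by linarith)
  have := Real.log_nonneg (show 1 ≤ ‖z‖ - 2 * lam by linarith)
  linarith

/-! ### Integrals over product spaces -/

lemma measurePreserving_cons {Q : Type*} [MeasurableSpace Q] (μ : Measure Q) [SigmaFinite μ]
    (n : ℕ) : MeasurePreserving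
      (fun p : Q × (Fin n → Q) => (Fin.cons p.1 p.2 : Fin (n + 1) → Q))
      (μ.prod (Measure.pi fun _ : Fin n => μ)) (Measure.pi fun _ : Fin (n + 1) => μ) := by
  convert (measurePreserving_piFinSuccAbove (fun _ : Fin (n + 1) => μ) 0).symm using 1
  ext p i
  simp [MeasurableEquiv.piFinSuccAbove_symm_apply, Fin.insertNthEquiv]

lemma lintegral_fin_prod {Q : Type*} [MeasurableSpace Q] (μ : Measure Q) [SigmaFinite μ] (n : ℕ)
    (f : Fin n → Q → ℝ≥0∞) (hf : ∀ i, Measurable (f i)) :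
    ∫⁻ x, ∏ i, f i (x i) ∂(Measure.pi fun _ : Fin n => μ) = ∏ i, ∫⁻ q, f i q ∂μ := by
  induction n with
  | zero => simp
  | succ n ih =>
    have hm : Measurable fun x : Fin (n + 1) → Q => ∏ i, f i (x i) :=
      Finset.measurable_prod _ fun i _ => (hf i).comp (measurable_pi_apply i)
    rw [← (measurePreserving_cons μ n).lintegral_comp hm]
    simp only [Fin.prod_univ_succ, Fin.cons_zero, Fin.cons_succ]
    rw [lintegral_prod_mul (f := f 0) (g := fun p : Fin n → Q => ∏ i, f (Fin.succ i) (p i))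
      (hf 0).aemeasurable
      (Finset.measurable_prod _ fun i _ => (hf i.succ).comp (measurable_pi_apply i)).aemeasurable,
      ih _ fun i => hf i.succ]

lemma pow_le_lintegral_pairwise {Q : Type*} [MeasurableSpace Q] (μ : Measure Q) [SigmaFinite μ]
    (w : Q → ℝ≥0∞) (hw : Measurable w) (R : Q → Q → Prop) (hRs : ∀ p q, R p q → R q p)
    (hR : MeasurableSet {pq : Q × Q | R pq.1 pq.2}) (a : ℝ≥0∞) (n : ℕ)
    (h : ∀ k < n, ∀ p : Fin k → Q, a ≤ ∫⁻ q in {q | ∀ j, R (p j) q}, w q ∂μ) :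
    a ^ n ≤ ∫⁻ p in {p : Fin n → Q | ∀ i j, i ≠ j → R (p i) (p j)}, ∏ i, w (p i)
      ∂(Measure.pi fun _ : Fin n => μ) := by
  have hmeas : ∀ k, MeasurableSet {p : Fin k → Q | ∀ i j, i ≠ j → R (p i) (p j)} := by
    intro k
    simp only [Set.ofPred_forall]
    refine MeasurableSet.iInter fun i => MeasurableSet.iInter fun j => MeasurableSet.iInter fun _ =>
      ?_
    exact hR.preimage
      ((measurable_pi_apply (X := fun _ : Fin k => Q) i).prodMk (measurable_pi_apply j))
  induction n with
  | zero => simp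
  | succ n ih =>
    have ih' := ih fun k hk => h k (hk.trans n.lt_succ_self)
    rw [← lintegral_indicator (hmeas _)] at ih' ⊢
    have hwp : ∀ k, Measurable fun p : Fin k → Q => ∏ i, w (p i) := fun k =>
      Finset.measurable_prod _ fun i _ => hw.comp (measurable_pi_apply i)
    have hF : ∀ k, Measurable ({p : Fin k → Q | ∀ i j, i ≠ j → R (p i) (p j)}.indicator
      fun p => ∏ i, w (p i)) := fun k => (hwp k).indicator (hmeas k)
    have hc : Measurable fun z : Q × (Fin n → Q) =>
        {p : Fin (n + 1) → Q | ∀ i j, i ≠ j → R (p i) (p j)}.indicator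
          (fun p => ∏ i, w (p i)) (Fin.cons z.1 z.2) :=
      (hF (n + 1)).comp (measurePreserving_cons μ n).measurable
    rw [← (measurePreserving_cons μ n).lintegral_comp (hF (n + 1)),
      lintegral_prod_symm' _ hc, pow_succ, mul_comm]
    calc a * a ^ n ≤ a * _ := by gcongr
      _ = ∫⁻ p, a * ({p : Fin n → Q | ∀ i j, i ≠ j → R (p i) (p j)}.indicator
          (fun p => ∏ i, w (p i)) p) ∂(Measure.pi fun _ : Fin n => μ) :=
        (lintegral_const_mul _ (hF n)).symm
      _ ≤ _ := by
        refine lintegral_mono fun p => ?_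
        by_cases hp : ∀ i j, i ≠ j → R (p i) (p j)
        · rw [Set.indicator_of_mem (by exact hp), mul_comm]
          refine (mul_le_mul_right (h n n.lt_succ_self p) _).trans ?_
          have hS : MeasurableSet {q | ∀ j, R (p j) q} := by
            simp only [Set.ofPred_forall]
            exact MeasurableSet.iInter fun j => hR.preimage measurable_prodMk_left
          rw [← lintegral_const_mul _ hw, ← lintegral_indicator hS]
          refine lintegral_mono fun q => ?_
          by_cases hq : ∀ j, R (p j) q
          · rw [Set.indicator_of_mem (by exact hq), Set.indicator_of_mem]
            · simp [Fin.prod_univ_succ, mul_comm]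
            · intro i j hij
              induction i using Fin.cases with
              | zero =>
                induction j using Fin.cases with
                | zero => exact absurd rfl hij
                | succ j => simpa using hRs _ _ (hq j)
              | succ i =>
                induction j using Fin.cases with
                | zero => simpa using hq i
                | succ j =>
                  simpa using hp i j fun e => hij (by rw [e])
          · rw [Set.indicator_of_notMem (by exact hq)]; exact zero_le
        · rw [Set.indicator_of_notMem (by exact hp)]; simp

lemma measurableSet_box (a b : ℝ) : MeasurableSet {x : E2 | ∀ i, x i ∈ Set.Icc a b} := by
  simp only [Set.ofPred_forall]
  refine MeasurableSet.iInter fun i => ?_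
  exact measurableSet_Icc.preimage (by fun_prop)

lemma volume_box (a b : ℝ) :
    volume {x : E2 | ∀ i, x i ∈ Set.Icc a b} = ENNReal.ofReal (b - a) ^ 2 := by
  have h := (EuclideanSpace.volume_preserving_symm_measurableEquiv_toLp (Fin 2)).measure_preimage
    (s := Set.Icc (fun _ => a) (fun _ => b)) measurableSet_Icc.nullMeasurableSet
  rw [Real.volume_Icc_pi] at h
  simp only [Fin.prod_univ_two] at h
  rw [pow_two, ← h]
  congr 1
  ext x
  simp [Set.mem_Icc, Pi.le_def, forall_and]

lemma measurableSet_LamBox (N : ℕ) : MeasurableSet (LamBox N) := measurableSet_box _ _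

lemma volume_LamBox (N : ℕ) : volume (LamBox N) = N := by
  have := volume_box 0 (Real.sqrt N)
  unfold LamBox
  rw [this, sub_zero, ← ENNReal.ofReal_pow (Real.sqrt_nonneg _), Real.sq_sqrt (Nat.cast_nonneg N)]
  simp

lemma confSet_eq (N : ℕ) : confSet N =
    (Set.univ.pi fun _ : Fin N => LamBox N) ×ˢ (Set.univ.pi fun _ : Fin N => LamBox N) := by
  ext P; simp [confSet]

lemma measurableSet_confSet (N : ℕ) : MeasurableSet (confSet N) := by
  rw [confSet_eq]
  exact (MeasurableSet.univ_pi fun _ => measurableSet_LamBox N).prod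
    (MeasurableSet.univ_pi fun _ => measurableSet_LamBox N)

lemma volume_restrict_confSet (N : ℕ) :
    (volume : Measure ((Fin N → E2) × (Fin N → E2))).restrict (confSet N) =
      (Measure.pi fun _ : Fin N => volume.restrict (LamBox N)).prod
        (Measure.pi fun _ : Fin N => volume.restrict (LamBox N)) := by
  rw [confSet_eq, Measure.volume_eq_prod, ← Measure.prod_restrict, volume_pi,
    Measure.restrict_pi_pi]

instance isFiniteMeasure_LamBox (N : ℕ) :
    IsFiniteMeasure ((volume : Measure E2).restrict (LamBox N)) :=
  ⟨by rw [Measure.restrict_apply_univ, volume_LamBox]; exact ENNReal.natCast_lt_top N⟩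

/-! ### Partial matchings -/

lemma lintegral_matching_le (N : ℕ) (q : E2 → ℝ≥0∞) (hq : Measurable q) (S : Finset (Fin N))
    (h : S ↪ Fin N) :
    ∫⁻ P in confSet N, ∏ i : S, q (P.1 i - P.2 (h i)) ≤
      (N : ℝ≥0∞) ^ N * ((N : ℝ≥0∞) ^ (N - S.card) * (∫⁻ z, q z) ^ S.card) := by
  rw [volume_restrict_confSet]
  have hm : Measurable fun P : (Fin N → E2) × (Fin N → E2) =>
      ∏ i : S, q (P.1 i - P.2 (h i)) := by
    refine Finset.measurable_prod _ fun i _ => hq.comp ?_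
    exact ((measurable_pi_apply _).comp measurable_fst).sub
      ((measurable_pi_apply _).comp measurable_snd)
  rw [lintegral_prod_symm' _ hm]
  have hin : ∀ Y : Fin N → E2, ∫⁻ X, ∏ i : S, q (X i - Y (h i))
      ∂(Measure.pi fun _ : Fin N => (volume : Measure E2).restrict (LamBox N)) ≤
      (N : ℝ≥0∞) ^ (N - S.card) * (∫⁻ z, q z) ^ S.card := by
    intro Y
    set F : Fin N → E2 → ℝ≥0∞ :=
      fun i x => if hi : i ∈ S then q (x - Y (h ⟨i, hi⟩)) else 1 with hF
    have e : ∀ X : Fin N → E2, ∏ i : S, q (X i - Y (h i)) = ∏ i, F i (X i) := by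
      intro X
      rw [← Finset.prod_subset (Finset.subset_univ S) (fun i _ hi => by simp [hF, hi])]
      refine Eq.trans ?_ (Finset.prod_coe_sort S fun i => F i (X i))
      exact Finset.prod_congr rfl fun i _ => by simp [hF]
    have hFm : ∀ i, Measurable (F i) := by
      intro i
      by_cases hi : i ∈ S
      · simp only [hF, hi, dite_true]
        exact hq.comp (by fun_prop)
      · simp only [hF, hi, dite_false]
        exact measurable_const
    rw [lintegral_congr e, lintegral_fin_prod (volume.restrict (LamBox N)) N F hFm]
    calc _ ≤ ∏ i : Fin N, if i ∈ S then (∫⁻ z, q z) else (N : ℝ≥0∞) := by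
          refine Finset.prod_le_prod' fun i _ => ?_
          by_cases hi : i ∈ S
          · simp only [hF, hi, dite_true, if_true]
            refine (setLIntegral_le_lintegral _ _).trans (le_of_eq ?_)
            exact lintegral_sub_right_eq_self q _
          · simp [hF, hi, volume_LamBox]
      _ = _ := by
          rw [Finset.prod_ite, Finset.prod_const, Finset.prod_const, mul_comm]
          congr 2
          · rw [Finset.filter_not, Finset.filter_mem_eq_inter, Finset.univ_inter,
              ← Finset.compl_eq_univ_sdiff, Finset.card_compl, Fintype.card_fin]
          · simp
  refine (lintegral_mono hin).trans ?_
  rw [lintegral_const, Measure.pi_univ, mul_comm]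
  simp [volume_LamBox]

lemma sum_matchings (N : ℕ) (I : ℝ≥0∞) :
    ∑ S : Finset (Fin N), ∑ _h : S ↪ Fin N,
      (N : ℝ≥0∞) ^ N * ((N : ℝ≥0∞) ^ (N - S.card) * I ^ S.card) =
    ∑ m ∈ Finset.range (N + 1), (N.choose m : ℝ≥0∞) *
      ((N.descFactorial m : ℝ≥0∞) * ((N : ℝ≥0∞) ^ N * ((N : ℝ≥0∞) ^ (N - m) * I ^ m))) := by
  simp only [Finset.sum_const, Finset.card_univ, Fintype.card_embedding_eq, Fintype.card_coe,
    Fintype.card_fin]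
  have := Finset.sum_powerset_apply_card (fun m => N.descFactorial m •
    ((N : ℝ≥0∞) ^ N * ((N : ℝ≥0∞) ^ (N - m) * I ^ m))) (x := (Finset.univ : Finset (Fin N)))
  rw [Finset.powerset_univ, Finset.card_univ, Fintype.card_fin] at this
  rw [this]
  simp only [nsmul_eq_mul]

lemma exp_Ftil_le {N : ℕ} {lam β : ℝ} (hl : 0 < lam) (hl2 : lam < 1 / 2) (hβ : 0 ≤ β)
    (X Y : Fin N → E2) :
    ∃ S : Finset (Fin N), ∃ h : S ↪ Fin N, (∀ i : S, ‖X i - Y (h i)‖ < 2) ∧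
      Real.exp (-β * Ftil N lam X Y) ≤ ∏ i : S, Real.exp (β * gsm lam (X i - Y (h i))) := by
  set φ := phi1 (zconf X Y) with hφ
  set bOf : Fin N → Fin N := fun a => Sum.elim id id (φ (.inl a)) with hbOf
  set aOf : Fin N → Fin N := fun b => Sum.elim id id (φ (.inr b)) with haOf
  set cond : Fin N ⊕ Fin N → Prop := fun i => φ (φ i) = i ∧ charge i * charge (φ i) = -1
    with hcond
  have hL : ∀ a, cond (.inl a) → φ (.inl a) = .inr (bOf a) := by
    rintro a ⟨-, h⟩
    rcases e : φ (.inl a) with b | b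
    · rw [e] at h; norm_num [charge] at h
    · simp [hbOf, e]
  have hR : ∀ b, cond (.inr b) → φ (.inr b) = .inl (aOf b) := by
    rintro b ⟨-, h⟩
    rcases e : φ (.inr b) with a | a
    · simp [haOf, e]
    · rw [e] at h; norm_num [charge] at h
  have hsymm : ∀ i, cond i → cond (φ i) := by
    rintro i ⟨h1, h2⟩
    exact ⟨by rw [h1], by rw [h1, mul_comm]; exact h2⟩
  have hLR : ∀ a, cond (.inl a) → cond (.inr (bOf a)) ∧ aOf (bOf a) = a := by
    intro a ha
    have h1 := hsymm _ ha
    rw [hL a ha] at h1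
    refine ⟨h1, ?_⟩
    have h2 := ha.1
    rw [hL a ha] at h2
    simp [haOf, h2]
  have hRL : ∀ b, cond (.inr b) → cond (.inl (aOf b)) ∧ bOf (aOf b) = b := by
    intro b hb
    have h1 := hsymm _ hb
    rw [hR b hb] at h1
    refine ⟨h1, ?_⟩
    have h2 := hb.1
    rw [hR b hb] at h2
    simp [hbOf, h2]
  set T : Finset (Fin N) := Finset.univ.filter fun a => cond (.inl a) with hT
  have hF : -β * Ftil N lam X Y = ∑ a ∈ T, β * gsm lam (X a - Y (bOf a)) := by
    have e1 : ∑ i : Fin N ⊕ Fin N, (if cond i then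
        gsm lam (zconf X Y i - zconf X Y (φ i)) else 0)
        = 2 * ∑ a ∈ T, gsm lam (X a - Y (bOf a)) := by
      rw [Fintype.sum_sum_type, ← Finset.sum_filter, ← Finset.sum_filter, two_mul]
      congr 1
      · refine Finset.sum_congr rfl fun a ha => ?_
        rw [hL a (by simpa [hT] using ha)]; rfl
      · refine Finset.sum_nbij' aOf bOf ?_ ?_ ?_ ?_ ?_
        · intro b hb
          simpa [hT] using (hRL b (by simpa using hb)).1
        · intro a ha
          simpa using (hLR a (by simpa [hT] using ha)).1
        · intro b hb
          exact (hRL b (by simpa using hb)).2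
        · intro a ha
          exact (hLR a (by simpa [hT] using ha)).2
        · intro b hb
          have hb' : cond (.inr b) := by simpa using hb
          rw [hR b hb', (hRL b hb').2, gsm_sub_comm hl]
          rfl
    have e2 : Ftil N lam X Y = -(1 / 2) * (2 * ∑ a ∈ T, gsm lam (X a - Y (bOf a))) := by
      rw [← e1]; rfl
    rw [e2, ← Finset.mul_sum]; ring
  set S : Finset (Fin N) := T.filter fun a => ‖X a - Y (bOf a)‖ < 2 with hS
  have hST : ∀ a ∈ S, cond (.inl a) := fun a ha => by
    have := (Finset.mem_filter.1 ha).1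
    simpa [hT] using this
  refine ⟨S, ⟨fun i => bOf i, ?_⟩, ?_, ?_⟩
  · intro i j hij
    have h1 := (hLR i (hST i i.2)).2
    have h2 := (hLR j (hST j j.2)).2
    apply Subtype.ext
    rw [← h1, ← h2]
    exact congrArg aOf hij
  · intro i
    exact (Finset.mem_filter.1 i.2).2
  · rw [hF, ← Real.exp_sum]
    apply Real.exp_le_exp.2
    have e3 : ∑ i : S, β * gsm lam (X i - Y (bOf i)) = ∑ a ∈ S, β * gsm lam (X a - Y (bOf a)) :=
      Finset.sum_coe_sort S fun a => β * gsm lam (X a - Y (bOf a))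
    refine le_of_le_of_eq ?_ e3.symm
    rw [hS, ← Finset.sum_filter_add_sum_filter_not T (fun a => ‖X a - Y (bOf a)‖ < 2)]
    have : ∑ a ∈ T with ¬‖X a - Y (bOf a)‖ < 2, β * gsm lam (X a - Y (bOf a)) ≤ 0 := by
      refine Finset.sum_nonpos fun a ha => ?_
      exact mul_nonpos_of_nonneg_of_nonpos hβ
        (gsm_nonpos hl hl2 (not_lt.1 (Finset.mem_filter.1 ha).2))
    linarith

/-- The Boltzmann weight of a dipole. -/
def wgt (β lam : ℝ) (z : E2) : ℝ≥0∞ := ENNReal.ofReal (Real.exp (β * gsm lam z))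

lemma measurable_wgt (β : ℝ) {lam : ℝ} (hl : 0 < lam) : Measurable (wgt β lam) := by
  unfold wgt
  have := measurable_gsm hl
  fun_prop

lemma lintegral_exp_Ftil_le (N : ℕ) {lam β : ℝ} (hl : 0 < lam) (hl2 : lam < 1 / 2) (hβ : 0 ≤ β) :
    ∫⁻ P in confSet N, ENNReal.ofReal (Real.exp (-β * Ftil N lam P.1 P.2)) ≤
    ∑ m ∈ Finset.range (N + 1), (N.choose m : ℝ≥0∞) * ((N.descFactorial m : ℝ≥0∞) *
      ((N : ℝ≥0∞) ^ N * ((N : ℝ≥0∞) ^ (N - m) *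
        (∫⁻ z in Metric.ball 0 2, wgt β lam z) ^ m))) := by
  set q : E2 → ℝ≥0∞ := (Metric.ball (0 : E2) 2).indicator (wgt β lam) with hq
  have hqm : Measurable q := (measurable_wgt β hl).indicator measurableSet_ball
  rw [← sum_matchings, ← lintegral_indicator measurableSet_ball]
  have hterm : ∀ (S : Finset (Fin N)) (h : S ↪ Fin N), Measurable
      fun P : (Fin N → E2) × (Fin N → E2) => ∏ i : S, q (P.1 i - P.2 (h i)) := by
    intro S h
    refine Finset.measurable_prod _ fun i _ => hqm.comp ?_
    exact ((measurable_pi_apply _).comp measurable_fst).sub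
      ((measurable_pi_apply _).comp measurable_snd)
  calc _ ≤ ∫⁻ P in confSet N, ∑ S : Finset (Fin N), ∑ h : S ↪ Fin N,
        ∏ i : S, q (P.1 i - P.2 (h i)) := by
        refine lintegral_mono fun P => ?_
        obtain ⟨S, h, h1, h2⟩ := exp_Ftil_le hl hl2 hβ P.1 P.2
        calc ENNReal.ofReal (Real.exp (-β * Ftil N lam P.1 P.2))
            ≤ ENNReal.ofReal (∏ i : S, Real.exp (β * gsm lam (P.1 i - P.2 (h i)))) :=
              ENNReal.ofReal_le_ofReal h2
          _ = ∏ i : S, q (P.1 i - P.2 (h i)) := by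
              rw [ENNReal.ofReal_prod_of_nonneg fun i _ => (Real.exp_pos _).le]
              refine Finset.prod_congr rfl fun i _ => ?_
              rw [hq, Set.indicator_of_mem (by simpa using h1 i)]
              rfl
          _ ≤ ∑ h : S ↪ Fin N, ∏ i : S, q (P.1 i - P.2 (h i)) :=
              Finset.single_le_sum (f := fun h : S ↪ Fin N => ∏ i : S, q (P.1 i - P.2 (h i)))
                (fun _ _ => zero_le) (Finset.mem_univ h)
          _ ≤ _ := Finset.single_le_sum (f := fun S : Finset (Fin N) => ∑ h : S ↪ Fin N,
                ∏ i : S, q (P.1 i - P.2 (h i))) (fun _ _ => zero_le) (Finset.mem_univ S)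
    _ = ∑ S : Finset (Fin N), ∑ h : S ↪ Fin N, ∫⁻ P in confSet N,
        ∏ i : S, q (P.1 i - P.2 (h i)) := by
        rw [lintegral_finsetSum _ fun S _ => Finset.measurable_sum _ fun h _ => hterm S h]
        refine Finset.sum_congr rfl fun S _ => ?_
        rw [lintegral_finsetSum _ fun h _ => hterm S h]
    _ ≤ _ := Finset.sum_le_sum fun S _ => Finset.sum_le_sum fun h _ =>
        lintegral_matching_le N q hqm S h

/-! ### Separated dipole configurations -/

/-- All mutual distances between the dipoles `p` and `q` exceed `r`. -/
def DipSep (r : ℝ) (p q : E2 × E2) : Prop :=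
  r < ‖p.1 - q.1‖ ∧ r < ‖p.1 - q.2‖ ∧ r < ‖p.2 - q.1‖ ∧ r < ‖p.2 - q.2‖

/-- The dipoles of length at most `r` in the box. -/
def Dip (N : ℕ) (r : ℝ) : Set (E2 × E2) :=
  {q | q.1 ∈ LamBox N ∧ q.2 ∈ LamBox N ∧ ‖q.1 - q.2‖ ≤ r}

/-- The configurations of `N` short, mutually separated dipoles. -/
def Adm (N : ℕ) (r : ℝ) : Set (Fin N → E2 × E2) :=
  {p | (∀ i, p i ∈ Dip N r) ∧ ∀ i j, i ≠ j → DipSep r (p i) (p j)}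

lemma DipSep.symm {r : ℝ} {p q : E2 × E2} (h : DipSep r p q) : DipSep r q p := by
  obtain ⟨h1, h2, h3, h4⟩ := h
  rw [norm_sub_rev] at h1 h2 h3 h4
  exact ⟨h1, h3, h2, h4⟩

lemma DipSep.swap_left {r : ℝ} {p q : E2 × E2} (h : DipSep r p q) : DipSep r p.swap q := by
  obtain ⟨h1, h2, h3, h4⟩ := h
  exact ⟨h3, h4, h1, h2⟩

lemma swap_mem_Dip {N : ℕ} {r : ℝ} {q : E2 × E2} (h : q ∈ Dip N r) : q.swap ∈ Dip N r := by
  obtain ⟨h1, h2, h3⟩ := h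
  rw [norm_sub_rev] at h3
  exact ⟨h2, h1, h3⟩

lemma measurableSet_DipSep (r : ℝ) :
    MeasurableSet {pq : (E2 × E2) × (E2 × E2) | DipSep r pq.1 pq.2} := by
  have h : ∀ f g : (E2 × E2) × (E2 × E2) → E2, Measurable f → Measurable g →
      MeasurableSet {pq | r < ‖f pq - g pq‖} := fun f g hf hg =>
    measurableSet_lt measurable_const (hf.sub hg).norm
  have e : {pq : (E2 × E2) × (E2 × E2) | DipSep r pq.1 pq.2} =
      {pq | r < ‖pq.1.1 - pq.2.1‖} ∩ ({pq | r < ‖pq.1.1 - pq.2.2‖} ∩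
        ({pq | r < ‖pq.1.2 - pq.2.1‖} ∩ {pq | r < ‖pq.1.2 - pq.2.2‖})) := rfl
  rw [e]
  exact (h _ _ (by fun_prop) (by fun_prop)).inter ((h _ _ (by fun_prop) (by fun_prop)).inter
    ((h _ _ (by fun_prop) (by fun_prop)).inter (h _ _ (by fun_prop) (by fun_prop))))

lemma measurableSet_Dip (N : ℕ) (r : ℝ) : MeasurableSet (Dip N r) := by
  have e : Dip N r = Prod.fst ⁻¹' LamBox N ∩ (Prod.snd ⁻¹' LamBox N ∩
      {q : E2 × E2 | ‖q.1 - q.2‖ ≤ r}) := rfl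
  rw [e]
  exact ((measurableSet_LamBox N).preimage measurable_fst).inter
    (((measurableSet_LamBox N).preimage measurable_snd).inter
      (measurableSet_le (measurable_fst.sub measurable_snd).norm measurable_const))

lemma measurableSet_forall_DipSep {r : ℝ} {k : ℕ} (p : Fin k → E2 × E2) :
    MeasurableSet {q | ∀ j, DipSep r (p j) q} := by
  have e : {q | ∀ j, DipSep r (p j) q} =
      ⋂ j, Prod.mk (p j) ⁻¹' {pq : (E2 × E2) × (E2 × E2) | DipSep r pq.1 pq.2} := by
    ext q
    simp
  rw [e]
  exact MeasurableSet.iInter fun j => (measurableSet_DipSep r).preimage measurable_prodMk_left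

lemma measurableSet_pairwise_DipSep (N : ℕ) (r : ℝ) :
    MeasurableSet {p : Fin N → E2 × E2 | ∀ i j, i ≠ j → DipSep r (p i) (p j)} := by
  have e : {p : Fin N → E2 × E2 | ∀ i j, i ≠ j → DipSep r (p i) (p j)} =
      ⋂ i, ⋂ j, ⋂ _ : i ≠ j, (fun p : Fin N → E2 × E2 => (p i, p j)) ⁻¹'
        {pq : (E2 × E2) × (E2 × E2) | DipSep r pq.1 pq.2} := by
    ext p
    simp
  rw [e]
  exact MeasurableSet.iInter fun i => MeasurableSet.iInter fun j => MeasurableSet.iInter fun _ =>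
    (measurableSet_DipSep r).preimage ((measurable_pi_apply i).prodMk (measurable_pi_apply j))

lemma measurableSet_Adm (N : ℕ) (r : ℝ) : MeasurableSet (Adm N r) := by
  have e : Adm N r = (⋂ i, (fun p : Fin N → E2 × E2 => p i) ⁻¹' Dip N r) ∩
      {p | ∀ i j, i ≠ j → DipSep r (p i) (p j)} := by
    ext p
    simp [Adm]
  rw [e]
  exact (MeasurableSet.iInter fun i => (measurableSet_Dip N r).preimage
    (measurable_pi_apply i)).inter (measurableSet_pairwise_DipSep N r)

lemma le_volume_free {N k : ℕ} (hk : k < N) {r : ℝ} (hr : 0 < r) (hr2 : r ≤ 1 / 2)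
    (p : Fin k → E2 × E2) :
    ENNReal.ofReal (N - 4 * Real.sqrt N * r - 8 * Real.pi * N * r ^ 2) ≤
      volume ({x : E2 | ∀ i, x i ∈ Set.Icc r (Real.sqrt N - r)} \
        ⋃ j, (Metric.closedBall (p j).1 (2 * r) ∪ Metric.closedBall (p j).2 (2 * r))) := by
  have hN : (1 : ℝ) ≤ N := by exact_mod_cast (by omega : 1 ≤ N)
  have hs : (1 : ℝ) ≤ Real.sqrt N := Real.one_le_sqrt.2 hN
  have hs2 : Real.sqrt N ^ 2 = N := Real.sq_sqrt (by linarith)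
  have hball : ∀ x : E2, volume (Metric.closedBall x (2 * r))
      = ENNReal.ofReal (4 * Real.pi * r ^ 2) := by
    intro x
    rw [volume_closedBall_E2, ← ENNReal.ofReal_pow (by linarith),
      ← ENNReal.ofReal_mul (by positivity)]
    congr 1; ring
  have hU : volume (⋃ j, (Metric.closedBall (p j).1 (2 * r) ∪ Metric.closedBall (p j).2 (2 * r)))
      ≤ ENNReal.ofReal (8 * Real.pi * N * r ^ 2) := by
    refine (measure_iUnion_fintype_le _ _).trans ?_
    calc _ ≤ ∑ _j : Fin k, ENNReal.ofReal (8 * Real.pi * r ^ 2) := by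
          refine Finset.sum_le_sum fun j _ => (measure_union_le _ _).trans (le_of_eq ?_)
          rw [hball, hball, ← ENNReal.ofReal_add (by positivity) (by positivity)]
          congr 1; ring
      _ = ENNReal.ofReal (k * (8 * Real.pi * r ^ 2)) := by
          rw [Finset.sum_const, Finset.card_univ, Fintype.card_fin, nsmul_eq_mul,
            ENNReal.ofReal_mul (p := (k : ℝ)) (Nat.cast_nonneg k), ENNReal.ofReal_natCast]
      _ ≤ _ := by
          apply ENNReal.ofReal_le_ofReal
          have : (k : ℝ) ≤ N := by exact_mod_cast hk.le
          calc (k : ℝ) * (8 * Real.pi * r ^ 2) ≤ N * (8 * Real.pi * r ^ 2) := by gcongr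
            _ = _ := by ring
  refine le_trans ?_ (le_measure_sdiff (μ := (volume : Measure E2)))
  rw [volume_box, ← ENNReal.ofReal_pow (by linarith),
    ENNReal.ofReal_sub _ (by positivity)]
  refine tsub_le_tsub (ENNReal.ofReal_le_ofReal ?_) hU
  nlinarith

lemma le_lintegral_dipole {N k : ℕ} (hk : k < N) {r : ℝ} (hr : 0 < r) (hr2 : r ≤ 1 / 2)
    {f : E2 → ℝ≥0∞} (hf : Measurable f) (p : Fin k → E2 × E2) :
    ENNReal.ofReal (N - 4 * Real.sqrt N * r - 8 * Real.pi * N * r ^ 2) *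
      ∫⁻ z in Metric.closedBall 0 r, f z ≤
    ∫⁻ q in {q | ∀ j, DipSep r (p j) q}, (Dip N r).indicator (fun q => f (q.1 - q.2)) q := by
  set G := {x : E2 | ∀ i, x i ∈ Set.Icc r (Real.sqrt N - r)} \
        ⋃ j, (Metric.closedBall (p j).1 (2 * r) ∪ Metric.closedBall (p j).2 (2 * r)) with hG
  have hGm : MeasurableSet G := (measurableSet_box _ _).diff
    (MeasurableSet.iUnion fun j => measurableSet_closedBall.union measurableSet_closedBall)
  set f' : E2 → ℝ≥0∞ := (Metric.closedBall (0 : E2) r).indicator f with hf'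
  have hfm' : Measurable f' := hf.indicator measurableSet_closedBall
  set H : E2 × E2 → ℝ≥0∞ := fun q => G.indicator 1 q.1 * f' (q.1 - q.2) with hH
  have hHm : Measurable H := by
    refine Measurable.mul ?_ (hfm'.comp (by fun_prop))
    exact (measurable_one.indicator hGm).comp measurable_fst
  calc _ ≤ volume G * ∫⁻ z in Metric.closedBall 0 r, f z := by
        gcongr
        exact le_volume_free hk hr hr2 p
    _ = ∫⁻ q, H q := by
        rw [Measure.volume_eq_prod, lintegral_prod _ hHm.aemeasurable]
        simp only [hH]
        have : ∀ x : E2, ∫⁻ y, G.indicator 1 x * f' (x - y) =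
            G.indicator 1 x * ∫⁻ z in Metric.closedBall 0 r, f z := by
          intro x
          have hx : Measurable fun y => f' (x - y) :=
            hfm'.comp (measurable_const.sub measurable_id)
          rw [lintegral_const_mul _ hx, lintegral_sub_left_eq_self f' x,
            hf', lintegral_indicator measurableSet_closedBall]
        simp only [this]
        rw [lintegral_mul_const _ (measurable_one.indicator hGm), lintegral_indicator_one hGm]
    _ ≤ _ := by
        rw [← lintegral_indicator (measurableSet_forall_DipSep p)]
        refine lintegral_mono fun q => ?_
        by_cases h1 : q.1 ∈ G
        swap
        · simp [hH, h1]
        by_cases h2 : ‖q.1 - q.2‖ ≤ r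
        swap
        · have : q.1 - q.2 ∉ Metric.closedBall (0 : E2) r := by simpa using h2
          simp [hH, hf', this]
        obtain ⟨hb, hu⟩ := h1
        have hu' : ∀ j, 2 * r < ‖(p j).1 - q.1‖ ∧ 2 * r < ‖(p j).2 - q.1‖ := by
          intro j
          have : q.1 ∉ Metric.closedBall (p j).1 (2 * r) ∪ Metric.closedBall (p j).2 (2 * r) :=
            fun h => hu (Set.mem_iUnion.2 ⟨j, h⟩)
          simpa [Metric.mem_closedBall, dist_eq_norm', not_or] using this
        have hsep : ∀ j, DipSep r (p j) q := by
          intro j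
          have h3 : ∀ v : E2, ‖v - q.1‖ ≤ ‖v - q.2‖ + ‖q.1 - q.2‖ := by
            intro v
            have := norm_sub_le (v - q.2) (q.1 - q.2)
            rwa [sub_sub_sub_cancel_right] at this
          refine ⟨by linarith [(hu' j).1], ?_, by linarith [(hu' j).2], ?_⟩
          · linarith [(hu' j).1, h3 (p j).1]
          · linarith [(hu' j).2, h3 (p j).2]
        have hD : q ∈ Dip N r := by
          refine ⟨fun i => ⟨?_, ?_⟩, fun i => ?_, h2⟩
          · linarith [(hb i).1]
          · linarith [(hb i).2]
          · have h4 : |(q.1 - q.2) i| ≤ r := (PiLp.norm_apply_le (q.1 - q.2) i).trans h2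
            rw [PiLp.sub_apply, abs_le] at h4
            constructor <;> linarith [(hb i).1, (hb i).2, h4.1, h4.2]
        rw [Set.indicator_of_mem (by exact hsep), Set.indicator_of_mem hD]
        have h5 : q.1 ∈ G := ⟨hb, hu⟩
        have h6 : q.1 - q.2 ∈ Metric.closedBall (0 : E2) r := by simpa using h2
        simp [hH, hf', h5, h6]

lemma pow_le_lintegral_Adm (N : ℕ) {r : ℝ} (hr : 0 < r) (hr2 : r ≤ 1 / 2)
    {f : E2 → ℝ≥0∞} (hf : Measurable f) :
    (ENNReal.ofReal (N - 4 * Real.sqrt N * r - 8 * Real.pi * N * r ^ 2) *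
      ∫⁻ z in Metric.closedBall 0 r, f z) ^ N ≤
    ∫⁻ p in Adm N r, ∏ i, f ((p i).1 - (p i).2) := by
  have hm : Measurable fun q : E2 × E2 => f (q.1 - q.2) := hf.comp (by fun_prop)
  refine (pow_le_lintegral_pairwise (volume : Measure (E2 × E2)) _
    (hm.indicator (measurableSet_Dip N r)) (DipSep r) (fun _ _ h => h.symm)
    (measurableSet_DipSep r) _ N fun k hk p => le_lintegral_dipole hk hr hr2 hf p).trans ?_
  have hP := measurableSet_pairwise_DipSep N r
  rw [← lintegral_indicator hP, ← lintegral_indicator (measurableSet_Adm N r), volume_pi]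
  refine lintegral_mono fun p => ?_
  by_cases h1 : ∀ i j, i ≠ j → DipSep r (p i) (p j)
  swap
  · rw [Set.indicator_of_notMem (by exact h1)]; exact zero_le
  rw [Set.indicator_of_mem (by exact h1)]
  by_cases h2 : ∀ i, p i ∈ Dip N r
  · rw [Set.indicator_of_mem (by exact ⟨h2, h1⟩)]
    refine le_of_eq (Finset.prod_congr rfl fun i _ => ?_)
    rw [Set.indicator_of_mem (h2 i)]
  · push Not at h2
    obtain ⟨i, hi⟩ := h2
    rw [Finset.prod_eq_zero (Finset.mem_univ i) (Set.indicator_of_notMem hi _)]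
    exact zero_le

/-! ### The energy of a dipole configuration -/

/-- The interaction of two dipoles. -/
def dipInt (lam : ℝ) (p q : E2 × E2) : ℝ :=
  gsm lam (p.1 - q.1) + gsm lam (p.2 - q.2) - gsm lam (p.1 - q.2) - gsm lam (p.2 - q.1)

lemma dipInt_swap (lam : ℝ) (p q : E2 × E2) : dipInt lam p.swap q = -dipInt lam p q := by
  simp only [dipInt, Prod.fst_swap, Prod.snd_swap]; ring

lemma Flam_dipole {N : ℕ} {lam : ℝ} (hl : 0 < lam) (p : Fin N → E2 × E2) :
    Flam N lam (fun i => (p i).1) (fun i => (p i).2) =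
      -∑ i, gsm lam ((p i).1 - (p i).2) +
        (1 / 2) * ∑ i, ∑ j, if i = j then 0 else dipInt lam (p i) (p j) := by
  have e1 : ∑ i : Fin N, ∑ j : Fin N, gsm lam ((p i).1 - (p j).2)
      = ∑ i : Fin N, ∑ j : Fin N, gsm lam ((p i).2 - (p j).1) := by
    rw [Finset.sum_comm]
    exact Finset.sum_congr rfl fun i _ => Finset.sum_congr rfl fun j _ => gsm_sub_comm hl _ _
  have e2 : ∑ i : Fin N, ∑ j : Fin N, (gsm lam ((p i).1 - (p j).1) + gsm lam ((p i).2 - (p j).2)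
      - 2 * gsm lam ((p i).1 - (p j).2)) = ∑ i, ∑ j, dipInt lam (p i) (p j) := by
    simp only [dipInt, Finset.sum_add_distrib, Finset.sum_sub_distrib, ← Finset.mul_sum]
    linarith [e1]
  have e3 : ∑ i, ∑ j, dipInt lam (p i) (p j) = (∑ i, dipInt lam (p i) (p i)) +
      ∑ i, ∑ j, if i = j then 0 else dipInt lam (p i) (p j) := by
    rw [← Finset.sum_add_distrib]
    refine Finset.sum_congr rfl fun i _ => ?_
    have : ∀ j, dipInt lam (p i) (p j) = (if i = j then dipInt lam (p i) (p j) else 0) +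
        if i = j then 0 else dipInt lam (p i) (p j) := by
      intro j; split_ifs <;> simp
    rw [Finset.sum_congr rfl fun j _ => this j, Finset.sum_add_distrib, Finset.sum_ite_eq,
      if_pos (Finset.mem_univ i)]
  have e4 : ∑ i, dipInt lam (p i) (p i) = 2 * (N * (-Real.log lam + kappa)) -
      2 * ∑ i, gsm lam ((p i).1 - (p i).2) := by
    have : ∀ i, dipInt lam (p i) (p i) = 2 * (-Real.log lam + kappa) -
        2 * gsm lam ((p i).1 - (p i).2) := by
      intro i
      rw [dipInt, sub_self, sub_self, gsm_zero hl, gsm_sub_comm hl (p i).2]; ring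
    simp only [this, Finset.sum_sub_distrib, ← Finset.mul_sum, Finset.sum_const, Finset.card_univ,
      Fintype.card_fin, nsmul_eq_mul]
  unfold Flam
  rw [e2, e3, e4]; ring

lemma exists_gsm_bound (N : ℕ) {lam : ℝ} (hl : 0 < lam) :
    ∃ M, 0 ≤ M ∧ ∀ a ∈ LamBox N, ∀ b ∈ LamBox N, |gsm lam (a - b)| ≤ M := by
  have hbd : ∀ a ∈ LamBox N, ‖a‖ ≤ Real.sqrt (2 * N) := by
    intro a ha
    rw [EuclideanSpace.norm_eq]
    apply Real.sqrt_le_sqrt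
    simp only [Fin.sum_univ_two, Real.norm_eq_abs, sq_abs]
    have h : ∀ i, a i ^ 2 ≤ N := fun i => by
      have := pow_le_pow_left₀ (ha i).1 (ha i).2 2
      rwa [Real.sq_sqrt (Nat.cast_nonneg N)] at this
    linarith [h 0, h 1]
  refine ⟨|-Real.log lam + Kpot| + |Real.log (2 * Real.sqrt (2 * N) + 2 * lam)|
    + |Real.log (2 * lam)|, by positivity, fun a ha b hb => ?_⟩
  have h1 := gsm_le hl (a - b)
  have h2 := le_gsm hl (a - b)
  have h3 : ‖a - b‖ ≤ 2 * Real.sqrt (2 * N) := by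
    linarith [norm_sub_le a b, hbd a ha, hbd b hb]
  have h4 : Real.log (‖a - b‖ + 2 * lam) ≤ Real.log (2 * Real.sqrt (2 * N) + 2 * lam) :=
    Real.log_le_log (by positivity) (by linarith)
  rw [abs_le]
  constructor
  · linarith [le_abs_self (Real.log (2 * Real.sqrt (2 * N) + 2 * lam)),
      abs_nonneg (Real.log (2 * lam)), abs_nonneg (-Real.log lam + Kpot)]
  · linarith [le_abs_self (-Real.log lam + Kpot), abs_nonneg (Real.log (2 * lam)),
      abs_nonneg (Real.log (2 * Real.sqrt (2 * N) + 2 * lam))]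

/-- The product of the Boltzmann weights of the dipoles. -/
def dipW (N : ℕ) (β lam : ℝ) (p : Fin N → E2 × E2) : ℝ :=
  ∏ i, Real.exp (β * gsm lam ((p i).1 - (p i).2))

lemma measurable_gsm_comp {α : Type*} [MeasurableSpace α] {lam : ℝ} (hl : 0 < lam) {f g : α → E2}
    (hf : Measurable f) (hg : Measurable g) : Measurable fun x => gsm lam (f x - g x) :=
  (measurable_gsm hl).comp (hf.sub hg)

lemma measurable_dipW (N : ℕ) (β : ℝ) {lam : ℝ} (hl : 0 < lam) : Measurable (dipW N β lam) := by
  refine Finset.measurable_prod _ fun i _ => ?_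
  exact ((measurable_gsm_comp hl (measurable_fst.comp (measurable_pi_apply i))
    (measurable_snd.comp (measurable_pi_apply i))).const_mul β).exp

lemma measurable_dipInt {N : ℕ} {lam : ℝ} (hl : 0 < lam) (i j : Fin N) :
    Measurable fun p : Fin N → E2 × E2 => dipInt lam (p i) (p j) := by
  have h1 : ∀ i : Fin N, Measurable fun p : Fin N → E2 × E2 => (p i).1 := fun i =>
    measurable_fst.comp (measurable_pi_apply i)
  have h2 : ∀ i : Fin N, Measurable fun p : Fin N → E2 × E2 => (p i).2 := fun i =>
    measurable_snd.comp (measurable_pi_apply i)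
  exact (((measurable_gsm_comp hl (h1 i) (h1 j)).add (measurable_gsm_comp hl (h2 i) (h2 j))).sub
    (measurable_gsm_comp hl (h1 i) (h2 j))).sub (measurable_gsm_comp hl (h2 i) (h1 j))

lemma volume_Adm_lt_top (N : ℕ) (r : ℝ) : volume (Adm N r) < ⊤ := by
  have hsub : Adm N r ⊆ Set.univ.pi fun _ : Fin N => LamBox N ×ˢ LamBox N := by
    intro p hp i _
    exact ⟨(hp.1 i).1, (hp.1 i).2.1⟩
  refine (measure_mono hsub).trans_lt ?_
  rw [volume_pi, Measure.pi_pi]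
  refine ENNReal.prod_lt_top fun i _ => ?_
  rw [Measure.volume_eq_prod, Measure.prod_prod, volume_LamBox]
  exact ENNReal.mul_lt_top (ENNReal.natCast_lt_top N) (ENNReal.natCast_lt_top N)

lemma dipW_nonneg (N : ℕ) (β lam : ℝ) (p : Fin N → E2 × E2) : 0 ≤ dipW N β lam p :=
  Finset.prod_nonneg fun _ _ => (Real.exp_pos _).le

lemma exists_dipW_bound (N : ℕ) {β lam : ℝ} (hβ : 0 ≤ β) (hl : 0 < lam) (r : ℝ) :
    ∃ M, 0 ≤ M ∧ ∀ p ∈ Adm N r, dipW N β lam p ≤ M := by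
  obtain ⟨M, hM, h⟩ := exists_gsm_bound N hl
  refine ⟨∏ _i : Fin N, Real.exp (β * M), by positivity, fun p hp => ?_⟩
  refine Finset.prod_le_prod (fun _ _ => (Real.exp_pos _).le) fun i _ => ?_
  have := (abs_le.1 (h _ (hp.1 i).1 _ (hp.1 i).2.1)).2
  gcongr

lemma integrableOn_dipW (N : ℕ) {β lam : ℝ} (hβ : 0 ≤ β) (hl : 0 < lam) (r : ℝ) :
    IntegrableOn (dipW N β lam) (Adm N r) := by
  obtain ⟨M, hM, h⟩ := exists_dipW_bound N hβ hl r
  refine Measure.integrableOn_of_bounded (M := M) (volume_Adm_lt_top N r).ne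
    (measurable_dipW N β hl).aestronglyMeasurable ?_
  refine (ae_restrict_iff' (measurableSet_Adm N r)).2 (Filter.Eventually.of_forall fun p hp => ?_)
  rw [Real.norm_of_nonneg (dipW_nonneg N β lam p)]
  exact h p hp

lemma integrableOn_dipW_mul_dipInt (N : ℕ) {β lam : ℝ} (hβ : 0 ≤ β) (hl : 0 < lam) (r : ℝ)
    (i j : Fin N) :
    IntegrableOn (fun p => dipW N β lam p * dipInt lam (p i) (p j)) (Adm N r) := by
  obtain ⟨M, hM, h⟩ := exists_gsm_bound N hl
  refine Integrable.mul_bdd (c := 4 * M) (integrableOn_dipW N hβ hl r)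
    (measurable_dipInt hl i j).aestronglyMeasurable ?_
  refine (ae_restrict_iff' (measurableSet_Adm N r)).2 (Filter.Eventually.of_forall fun p hp => ?_)
  obtain ⟨i1, i2, -⟩ := hp.1 i
  obtain ⟨j1, j2, -⟩ := hp.1 j
  have h1 := abs_le.1 (h _ i1 _ j1)
  have h2 := abs_le.1 (h _ i2 _ j2)
  have h3 := abs_le.1 (h _ i1 _ j2)
  have h4 := abs_le.1 (h _ i2 _ j1)
  rw [Real.norm_eq_abs, abs_le]
  unfold dipInt
  constructor <;> linarith [h1.1, h1.2, h2.1, h2.2, h3.1, h3.2, h4.1, h4.2]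

/-- Swapping the two charges of the `i`-th dipole. -/
def swapAt {N : ℕ} (i : Fin N) (p : Fin N → E2 × E2) : Fin N → E2 × E2 :=
  fun k => (if k = i then Prod.swap else id) (p k)

lemma swapAt_self {N : ℕ} (i : Fin N) (p : Fin N → E2 × E2) : swapAt i p i = (p i).swap := by
  simp [swapAt]

lemma swapAt_of_ne {N : ℕ} {i k : Fin N} (h : k ≠ i) (p : Fin N → E2 × E2) :
    swapAt i p k = p k := by
  simp [swapAt, h]

lemma swapAt_involutive {N : ℕ} (i : Fin N) : Function.Involutive (swapAt i) := by
  intro p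
  ext1 k
  rcases eq_or_ne k i with rfl | h
  · rw [swapAt_self, swapAt_self, Prod.swap_swap]
  · rw [swapAt_of_ne h, swapAt_of_ne h]

lemma measurePreserving_swapAt {N : ℕ} (i : Fin N) :
    MeasurePreserving (swapAt i) volume volume := by
  refine volume_preserving_pi fun k => ?_
  split_ifs
  · exact Measure.measurePreserving_swap
  · exact MeasurePreserving.id _

lemma swapAt_mem_Adm {N : ℕ} {r : ℝ} (i : Fin N) {p : Fin N → E2 × E2} (h : p ∈ Adm N r) :
    swapAt i p ∈ Adm N r := by
  refine ⟨fun k => ?_, fun k l hkl => ?_⟩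
  · rcases eq_or_ne k i with rfl | hk
    · rw [swapAt_self]; exact swap_mem_Dip (h.1 k)
    · rw [swapAt_of_ne hk]; exact h.1 k
  · have h1 := h.2 k l hkl
    rcases eq_or_ne k i with rfl | hk
    · rw [swapAt_self, swapAt_of_ne hkl.symm]; exact h1.swap_left
    · rw [swapAt_of_ne hk]
      rcases eq_or_ne l i with rfl | hl
      · rw [swapAt_self]; exact h1.symm.swap_left.symm
      · rw [swapAt_of_ne hl]; exact h1

lemma dipW_swapAt {N : ℕ} (β : ℝ) {lam : ℝ} (hl : 0 < lam) (i : Fin N) (p : Fin N → E2 × E2) :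
    dipW N β lam (swapAt i p) = dipW N β lam p := by
  refine Finset.prod_congr rfl fun k _ => ?_
  rcases eq_or_ne k i with rfl | hk
  · rw [swapAt_self, Prod.fst_swap, Prod.snd_swap, gsm_sub_comm hl]
  · rw [swapAt_of_ne hk]

lemma integral_dipW_mul_dipInt (N : ℕ) (β : ℝ) {lam : ℝ} (hl : 0 < lam) (r : ℝ)
    {i j : Fin N} (hij : i ≠ j) :
    ∫ p in Adm N r, dipW N β lam p * dipInt lam (p i) (p j) = 0 := by
  have hpre : swapAt i ⁻¹' Adm N r = Adm N r := by
    ext p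
    refine ⟨fun h => ?_, fun h => swapAt_mem_Adm i h⟩
    have := swapAt_mem_Adm i h
    rwa [swapAt_involutive i p] at this
  have h := (measurePreserving_swapAt i).setIntegral_preimage_emb
    (MeasurableEquiv.ofInvolutive (swapAt i) (swapAt_involutive i)
      (measurePreserving_swapAt i).measurable).measurableEmbedding
    (fun p => dipW N β lam p * dipInt lam (p i) (p j)) (Adm N r)
  rw [hpre] at h
  simp only [dipW_swapAt β hl, swapAt_self, swapAt_of_ne hij.symm, dipInt_swap, mul_neg,
    integral_neg] at h
  linarith

lemma ofReal_integral_le_lintegral {α : Type*} [MeasurableSpace α] {μ : Measure α} {f : α → ℝ}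
    (hf : Integrable f μ) : ENNReal.ofReal (∫ x, f x ∂μ) ≤ ∫⁻ x, ENNReal.ofReal (f x) ∂μ := by
  rw [integral_eq_lintegral_pos_part_sub_lintegral_neg_part hf]
  exact (ENNReal.ofReal_le_ofReal (sub_le_self _ ENNReal.toReal_nonneg)).trans
    ENNReal.ofReal_toReal_le

lemma lintegral_dipW_le (N : ℕ) {β lam : ℝ} (hβ : 0 ≤ β) (hl : 0 < lam) (r : ℝ) :
    ∫⁻ p in Adm N r, ENNReal.ofReal (dipW N β lam p) ≤
      ∫⁻ p in Adm N r, ENNReal.ofReal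
        (Real.exp (-β * Flam N lam (fun i => (p i).1) (fun i => (p i).2))) := by
  set E : (Fin N → E2 × E2) → ℝ := fun p =>
    ∑ i, ∑ j, if i = j then 0 else dipW N β lam p * dipInt lam (p i) (p j) with hE
  have hInt : ∀ i j : Fin N, IntegrableOn
      (fun p => if i = j then 0 else dipW N β lam p * dipInt lam (p i) (p j)) (Adm N r) := by
    intro i j
    split_ifs
    · exact integrableOn_zero
    · exact integrableOn_dipW_mul_dipInt N hβ hl r i j
  have hEi : IntegrableOn E (Adm N r) :=
    integrable_finsetSum _ fun i _ => integrable_finsetSum _ fun j _ => hInt i j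
  have hE0 : ∫ p in Adm N r, E p = 0 := by
    simp only [hE]
    rw [integral_finsetSum _ fun i _ => integrable_finsetSum _ fun j _ => hInt i j]
    refine Finset.sum_eq_zero fun i _ => ?_
    rw [integral_finsetSum _ fun j _ => hInt i j]
    refine Finset.sum_eq_zero fun j _ => ?_
    split_ifs with h
    · simp
    · exact integral_dipW_mul_dipInt N β hl r h
  have hW := integrableOn_dipW N hβ hl r
  calc ∫⁻ p in Adm N r, ENNReal.ofReal (dipW N β lam p)
      = ENNReal.ofReal (∫ p in Adm N r, dipW N β lam p) :=
        (ofReal_integral_eq_lintegral_ofReal hW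
          (Filter.Eventually.of_forall (dipW_nonneg N β lam))).symm
    _ = ENNReal.ofReal (∫ p in Adm N r, (dipW N β lam p - β / 2 * E p)) := by
        rw [integral_sub hW (hEi.const_mul _), integral_const_mul, hE0, mul_zero, sub_zero]
    _ ≤ ∫⁻ p in Adm N r, ENNReal.ofReal (dipW N β lam p - β / 2 * E p) :=
        ofReal_integral_le_lintegral (hW.sub (hEi.const_mul _))
    _ ≤ _ := by
        refine lintegral_mono fun p => ENNReal.ofReal_le_ofReal ?_
        rw [Flam_dipole hl]
        set T := ∑ i, ∑ j, if i = j then 0 else dipInt lam (p i) (p j) with hT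
        have e1 : E p = dipW N β lam p * T := by
          simp only [hE, hT, Finset.mul_sum, mul_ite, mul_zero]
        have e2 : Real.exp (-β * (-∑ i, gsm lam ((p i).1 - (p i).2) + 1 / 2 * T)) =
            dipW N β lam p * Real.exp (-(β / 2) * T) := by
          rw [dipW, ← Real.exp_sum, ← Real.exp_add, ← Finset.mul_sum]
          congr 1; ring
        rw [e1, e2]
        have h1 := Real.add_one_le_exp (-(β / 2) * T)
        have h2 := mul_le_mul_of_nonneg_left h1 (dipW_nonneg N β lam p)
        linarith

/-! ### The partition function -/

lemma Flam_comp_perm {N : ℕ} (lam : ℝ) (X Y : Fin N → E2) (σ : Equiv.Perm (Fin N)) :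
    Flam N lam X (fun i => Y (σ i)) = Flam N lam X Y := by
  have h1 : ∑ i, ∑ j, gsm lam (Y (σ i) - Y (σ j)) = ∑ i, ∑ j, gsm lam (Y i - Y j) := by
    rw [Equiv.sum_comp σ fun i => ∑ j, gsm lam (Y i - Y (σ j))]
    exact Finset.sum_congr rfl fun i _ => Equiv.sum_comp σ fun j => gsm lam (Y i - Y j)
  have h2 : ∑ i, ∑ j, gsm lam (X i - Y (σ j)) = ∑ i, ∑ j, gsm lam (X i - Y j) :=
    Finset.sum_congr rfl fun i _ => Equiv.sum_comp σ fun j => gsm lam (X i - Y j)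
  simp only [Flam, Finset.sum_add_distrib, Finset.sum_sub_distrib, ← Finset.mul_sum, h1, h2]

lemma measurable_Flam (N : ℕ) {lam : ℝ} (hl : 0 < lam) :
    Measurable fun P : (Fin N → E2) × (Fin N → E2) => Flam N lam P.1 P.2 := by
  have h1 : ∀ i : Fin N, Measurable fun P : (Fin N → E2) × (Fin N → E2) => P.1 i := fun i =>
    (measurable_pi_apply i).comp measurable_fst
  have h2 : ∀ i : Fin N, Measurable fun P : (Fin N → E2) × (Fin N → E2) => P.2 i := fun i =>
    (measurable_pi_apply i).comp measurable_snd
  unfold Flam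
  refine ((Finset.measurable_sum _ fun i _ => Finset.measurable_sum _ fun j _ => ?_).const_mul
    _).sub_const _
  exact ((measurable_gsm_comp hl (h1 i) (h1 j)).add (measurable_gsm_comp hl (h2 i) (h2 j))).sub
    ((measurable_gsm_comp hl (h1 i) (h2 j)).const_mul 2)

/-- The Boltzmann factor. -/
def bolt (N : ℕ) (β lam : ℝ) (P : (Fin N → E2) × (Fin N → E2)) : ℝ≥0∞ :=
  ENNReal.ofReal (Real.exp (-β * Flam N lam P.1 P.2))

lemma measurable_bolt (N : ℕ) (β : ℝ) {lam : ℝ} (hl : 0 < lam) : Measurable (bolt N β lam) :=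
  ((measurable_Flam N hl).const_mul (-β)).exp.ennreal_ofReal

/-- Pairing the positive charges with the negative ones according to a permutation. -/
def pairUp {N : ℕ} (σ : Equiv.Perm (Fin N)) (P : (Fin N → E2) × (Fin N → E2)) :
    Fin N → E2 × E2 :=
  fun i => (P.1 i, P.2 (σ i))

lemma measurePreserving_pairUp {N : ℕ} (σ : Equiv.Perm (Fin N)) :
    MeasurePreserving (pairUp σ) volume volume := by
  have h1 : MeasurePreserving (fun Y : Fin N → E2 => fun i => Y (σ i)) volume volume := by
    convert (volume_measurePreserving_piCongrLeft (fun _ : Fin N => E2) σ.symm) using 1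
    ext Y i
    have := MeasurableEquiv.piCongrLeft_apply_apply (β := fun _ : Fin N => E2) σ.symm Y (σ i)
    rw [σ.symm_apply_apply] at this
    rw [this]
  have h2 := (volume_measurePreserving_arrowProdEquivProdArrow E2 E2 (Fin N)).symm
  exact h2.comp ((MeasurePreserving.id volume).prod h1)

lemma pairUp_preimage_disjoint {N : ℕ} {r : ℝ} {σ τ : Equiv.Perm (Fin N)} (h : σ ≠ τ) :
    Disjoint (pairUp σ ⁻¹' Adm N r) (pairUp τ ⁻¹' Adm N r) := by
  rw [Set.disjoint_left]
  intro P h1 h2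
  apply h
  ext1 i
  by_contra hne
  obtain ⟨k, hk⟩ := σ.surjective (τ i)
  have hki : k ≠ i := fun e => hne (by rw [← hk, e])
  have h3 := (h1.2 i k hki.symm).2.1
  have h4 := (h2.1 i).2.2
  simp only [pairUp] at h3 h4
  rw [hk] at h3
  linarith

lemma factorial_mul_le_lintegral_bolt (N : ℕ) (β : ℝ) {lam : ℝ} (hl : 0 < lam) (r : ℝ) :
    (N.factorial : ℝ≥0∞) * ∫⁻ p in Adm N r, ENNReal.ofReal
        (Real.exp (-β * Flam N lam (fun i => (p i).1) (fun i => (p i).2))) ≤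
      ∫⁻ P in confSet N, bolt N β lam P := by
  set b : (Fin N → E2 × E2) → ℝ≥0∞ := fun p => ENNReal.ofReal
    (Real.exp (-β * Flam N lam (fun i => (p i).1) (fun i => (p i).2))) with hb
  have hbm : Measurable b := (measurable_bolt N β hl).comp
    (g := bolt N β lam) (f := fun p : Fin N → E2 × E2 => (fun i => (p i).1, fun i => (p i).2))
    ((measurable_pi_lambda _ fun i => measurable_fst.comp (measurable_pi_apply i)).prodMk
      (measurable_pi_lambda _ fun i => measurable_snd.comp (measurable_pi_apply i)))
  have hσ : ∀ σ : Equiv.Perm (Fin N),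
      ∫⁻ P in pairUp σ ⁻¹' Adm N r, bolt N β lam P = ∫⁻ p in Adm N r, b p := by
    intro σ
    rw [← (measurePreserving_pairUp σ).setLIntegral_comp_preimage (measurableSet_Adm N r) hbm]
    refine lintegral_congr fun P => ?_
    simp only [hb, pairUp, bolt, Flam_comp_perm]
  calc (N.factorial : ℝ≥0∞) * ∫⁻ p in Adm N r, b p
      = ∑ σ : Equiv.Perm (Fin N), ∫⁻ P in pairUp σ ⁻¹' Adm N r, bolt N β lam P := by
        simp only [hσ, Finset.sum_const, Finset.card_univ, Fintype.card_perm, Fintype.card_fin,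
          nsmul_eq_mul]
    _ = ∫⁻ P in ⋃ σ ∈ (Finset.univ : Finset (Equiv.Perm (Fin N))), pairUp σ ⁻¹' Adm N r,
          bolt N β lam P := by
        refine (lintegral_biUnion_finset (fun σ _ τ _ hστ => pairUp_preimage_disjoint hστ)
          (fun σ _ => (measurePreserving_pairUp σ).measurable (measurableSet_Adm N r)) _).symm
    _ ≤ _ := by
        refine lintegral_mono_set (Set.iUnion₂_subset fun σ _ P hP => ⟨fun i => ?_, fun i => ?_⟩)
        · exact (hP.1 i).1
        · have := (hP.1 (σ.symm i)).2.1
          simpa [pairUp] using this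

lemma le_lintegral_bolt (N : ℕ) {β lam r : ℝ} (hβ : 0 ≤ β) (hl : 0 < lam) (hr : 0 < r)
    (hr2 : r ≤ 1 / 2) :
    (N.factorial : ℝ≥0∞) *
      (ENNReal.ofReal (N - 4 * Real.sqrt N * r - 8 * Real.pi * N * r ^ 2) *
        ∫⁻ z in Metric.closedBall 0 r, wgt β lam z) ^ N ≤
      ∫⁻ P in confSet N, bolt N β lam P := by
  refine le_trans (mul_le_mul_right ?_ _) (factorial_mul_le_lintegral_bolt N β hl r)
  refine (pow_le_lintegral_Adm N hr hr2 (measurable_wgt β hl)).trans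
    (le_trans (le_of_eq ?_) (lintegral_dipW_le N hβ hl r))
  refine lintegral_congr fun p => ?_
  rw [dipW, ENNReal.ofReal_prod_of_nonneg fun i _ => (Real.exp_pos _).le]
  rfl

lemma volume_confSet_lt_top (N : ℕ) : volume (confSet N) < ⊤ := by
  rw [← Measure.restrict_apply_univ, volume_restrict_confSet]
  exact measure_lt_top _ _

lemma integrableOn_exp_Flam (N : ℕ) {β lam : ℝ} (hβ : 0 ≤ β) (hl : 0 < lam) :
    IntegrableOn (fun P : (Fin N → E2) × (Fin N → E2) => Real.exp (-β * Flam N lam P.1 P.2))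
      (confSet N) := by
  obtain ⟨M, hM, h⟩ := exists_gsm_bound N hl
  refine Measure.integrableOn_of_bounded
    (M := Real.exp (β * ((1 / 2) * ∑ _i : Fin N, ∑ _j : Fin N, 4 * M
      + |N * (-Real.log lam + kappa)|)))
    (volume_confSet_lt_top N).ne
    ((measurable_Flam N hl).const_mul (-β)).exp.aestronglyMeasurable ?_
  refine (ae_restrict_iff' (measurableSet_confSet N)).2 (Filter.Eventually.of_forall fun P hP => ?_)
  rw [Real.norm_of_nonneg (Real.exp_pos _).le]
  apply Real.exp_le_exp.2
  have h1 : -(∑ i : Fin N, ∑ j : Fin N, (gsm lam (P.1 i - P.1 j) + gsm lam (P.2 i - P.2 j)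
      - 2 * gsm lam (P.1 i - P.2 j))) ≤ ∑ _i : Fin N, ∑ _j : Fin N, 4 * M := by
    simp only [← Finset.sum_neg_distrib]
    refine Finset.sum_le_sum fun i _ => Finset.sum_le_sum fun j _ => ?_
    have a1 := abs_le.1 (h _ (hP.1 i) _ (hP.1 j))
    have a2 := abs_le.1 (h _ (hP.2 i) _ (hP.2 j))
    have a3 := abs_le.1 (h _ (hP.1 i) _ (hP.2 j))
    linarith [a1.1, a2.1, a3.2]
  rw [neg_mul, ← mul_neg]
  refine mul_le_mul_of_nonneg_left ?_ hβ
  unfold Flam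
  linarith [le_abs_self (N * (-Real.log lam + kappa))]

lemma ofReal_Zpart (N : ℕ) {β lam : ℝ} (hβ : 0 ≤ β) (hl : 0 < lam) :
    ENNReal.ofReal (Zpart N β lam) = ∫⁻ P in confSet N, bolt N β lam P :=
  ofReal_integral_eq_lintegral_ofReal (integrableOn_exp_Flam N hβ hl)
    (Filter.Eventually.of_forall fun _ => (Real.exp_pos _).le)

lemma ofReal_integral_Gibbs_le (N : ℕ) {β lam : ℝ} (hβ : 0 ≤ β) (hl : 0 < lam) :
    ENNReal.ofReal (∫ P, Real.exp (β * (Flam N lam P.1 P.2 - Ftil N lam P.1 P.2))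
        ∂(Gibbs N β lam)) ≤
      (∫⁻ P in confSet N, bolt N β lam P)⁻¹ *
        ∫⁻ P in confSet N, ENNReal.ofReal (Real.exp (-β * Ftil N lam P.1 P.2)) := by
  by_cases hi : Integrable (fun P : (Fin N → E2) × (Fin N → E2) =>
      Real.exp (β * (Flam N lam P.1 P.2 - Ftil N lam P.1 P.2))) (Gibbs N β lam)
  swap
  · rw [integral_undef hi, ENNReal.ofReal_zero]; exact zero_le
  rw [ofReal_integral_eq_lintegral_ofReal hi
    (Filter.Eventually.of_forall fun _ => (Real.exp_pos _).le), Gibbs, ofReal_Zpart N hβ hl,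
    lintegral_smul_measure, smul_eq_mul]
  refine mul_le_mul_right ((lintegral_withDensity_le_lintegral_mul _
    (measurable_bolt N β hl) _).trans (le_of_eq (lintegral_congr fun P => ?_))) _
  rw [Pi.mul_apply, bolt, ← ENNReal.ofReal_mul (Real.exp_pos _).le, ← Real.exp_add]
  congr 2
  ring

/-! ### Comparison of the two partition functions -/

lemma sum_choose_descFactorial_le (N : ℕ) {t : ℝ} (ht : 0 < t) :
    ∑ m ∈ Finset.range (N + 1), (N.choose m : ℝ) * ((N.descFactorial m : ℝ) *
      ((N : ℝ) ^ (N - m) * t ^ m)) ≤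
      (N.factorial : ℝ) * (t ^ N * Real.exp (2 * (N / Real.sqrt t))) := by
  set s := Real.sqrt t with hs
  have hs0 : 0 < s := Real.sqrt_pos.2 ht
  have hs2 : s ^ 2 = t := Real.sq_sqrt ht.le
  rw [← Finset.sum_flip]
  calc _ ≤ ∑ k ∈ Finset.range (N + 1), (N.factorial : ℝ) * (t ^ N *
        (((N : ℝ) / s) ^ k / k.factorial) ^ 2) := by
        refine Finset.sum_le_sum fun k hk => ?_
        have hkN : k ≤ N := Nat.lt_succ_iff.1 (Finset.mem_range.1 hk)
        have h1 : (k.factorial : ℝ) * N.descFactorial (N - k) = N.factorial := by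
          have := Nat.factorial_mul_descFactorial (Nat.sub_le N k)
          rw [Nat.sub_sub_self hkN] at this
          exact_mod_cast this
        have hk0 : (0 : ℝ) < k.factorial := by exact_mod_cast k.factorial_pos
        have h2 : (N.descFactorial (N - k) : ℝ) = N.factorial / k.factorial := by
          rw [eq_div_iff hk0.ne', mul_comm, h1]
        rw [Nat.choose_symm hkN, Nat.sub_sub_self hkN, h2]
        have h3 : t ^ N = t ^ (N - k) * s ^ (2 * k) := by
          rw [pow_mul, hs2, ← pow_add, Nat.sub_add_cancel hkN]
        have h4 : (N.factorial : ℝ) * (t ^ N * (((N : ℝ) / s) ^ k / k.factorial) ^ 2) =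
            (N : ℝ) ^ k / k.factorial * (N.factorial / k.factorial *
              ((N : ℝ) ^ k * t ^ (N - k))) := by
          rw [h3, pow_mul', div_pow (N : ℝ) s]
          field_simp
        rw [h4]
        gcongr
        exact Nat.choose_le_pow_div k N
    _ = (N.factorial : ℝ) * (t ^ N *
        ∑ k ∈ Finset.range (N + 1), (((N : ℝ) / s) ^ k / k.factorial) ^ 2) := by
        rw [Finset.mul_sum, Finset.mul_sum]
    _ ≤ _ := by
        gcongr
        refine (Finset.sum_sq_le_sq_sum_of_nonneg fun k _ => by positivity).trans ?_
        rw [two_mul, Real.exp_add, ← sq]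
        gcongr
        exact Real.sum_le_exp_of_nonneg (by positivity) _

lemma exp_neg_two_mul_le {t : ℝ} (h0 : 0 ≤ t) (h : t ≤ 1 / 2) : Real.exp (-(2 * t)) ≤ 1 - t := by
  have h1 : 0 < 1 - t := by linarith
  have h2 : 1 / (1 - t) ≤ 2 * t + 1 := by
    rw [div_le_iff₀ h1]; nlinarith
  have h3 := h2.trans (Real.add_one_le_exp (2 * t))
  rw [Real.exp_neg]
  rw [div_le_iff₀ h1] at h3
  exact inv_le_of_inv_le₀ h1 (by rw [inv_eq_one_div, div_le_iff₀ h1]; exact h3)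

lemma exp_mul_le_free (N : ℕ) {r : ℝ} (hr : 0 ≤ r) (hr2 : r ≤ 1 / 34) :
    N * Real.exp (-(34 * r)) ≤ N - 4 * Real.sqrt N * r - 8 * Real.pi * N * r ^ 2 := by
  have h1 := exp_neg_two_mul_le (t := 17 * r) (by linarith) (by linarith)
  have hs : Real.sqrt N ≤ N :=
    Real.sqrt_le_iff.2 ⟨Nat.cast_nonneg N, by exact_mod_cast Nat.le_self_pow two_ne_zero N⟩
  have h2 : 8 * Real.pi * N * r ^ 2 ≤ 13 * (N * r) := by
    have : Real.pi * r ≤ 13 / 8 := by nlinarith [Real.pi_lt_four, Real.pi_pos]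
    have h3 : 0 ≤ N * r := by positivity
    nlinarith
  have h3 : Real.sqrt N * r ≤ N * r := by gcongr
  have h4 : N * Real.exp (-(2 * (17 * r))) ≤ N * (1 - 17 * r) := by gcongr
  rw [show 2 * (17 * r) = 34 * r by ring] at h4
  linarith

lemma lintegral_wgt_lt_top {β lam : ℝ} (hβ : 0 ≤ β) (hl : 0 < lam) :
    ∫⁻ z in Metric.ball 0 2, wgt β lam z < ⊤ := by
  refine (setLIntegral_mono (g := fun _ => ENNReal.ofReal
    (Real.exp (β * (-Real.log lam + Kpot)))) measurable_const fun z _ => ?_).trans_lt ?_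
  · apply ENNReal.ofReal_le_ofReal
    have := gsm_le hl z
    gcongr
  · rw [setLIntegral_const]
    exact ENNReal.mul_lt_top ENNReal.ofReal_lt_top measure_ball_lt_top

/-- The constant bounding the weight of a dipole in terms of its length. -/
def wgtC (β : ℝ) : ℝ := Real.exp (β * (Kpot + Real.log 4)) * (4 * Real.pi)

lemma wgtC_pos (β : ℝ) : 0 < wgtC β := by unfold wgtC; positivity

lemma lintegral_wgt_ball_le {β lam r : ℝ} (hβ : 0 ≤ β) (hl : 0 < lam) (hr : 0 < r) :
    ∫⁻ z in Metric.ball 0 2, wgt β lam z ≤ (∫⁻ z in Metric.closedBall 0 r, wgt β lam z) +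
      ENNReal.ofReal (wgtC β * r ^ (-β)) := by
  have hsub : Metric.ball (0 : E2) 2 ⊆
      Metric.closedBall 0 r ∪ (Metric.closedBall 0 2 \ Metric.closedBall 0 r) := fun z hz => by
    by_cases h : z ∈ Metric.closedBall 0 r
    · exact Or.inl h
    · exact Or.inr ⟨Metric.ball_subset_closedBall hz, h⟩
  refine (lintegral_mono_set hsub).trans ((lintegral_union_le _ _ _).trans ?_)
  gcongr
  calc _ ≤ ∫⁻ _z in Metric.closedBall (0 : E2) 2 \ Metric.closedBall 0 r,
        ENNReal.ofReal (Real.exp (β * (Kpot + Real.log 4)) * r ^ (-β)) := by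
        refine setLIntegral_mono measurable_const fun z hz => ENNReal.ofReal_le_ofReal ?_
        have hz1 : r < ‖z‖ := by simpa using hz.2
        have hz0 : z ≠ 0 := norm_pos_iff.1 (hr.trans hz1)
        have h1 := gsm_le_neg_log hl hz0
        have h2 := Real.log_le_log hr hz1.le
        rw [Real.rpow_def_of_pos hr, ← Real.exp_add]
        apply Real.exp_le_exp.2
        have : β * gsm lam z ≤ β * (-Real.log r + (Kpot + Real.log 4)) := by
          gcongr; linarith
        linarith
    _ ≤ ENNReal.ofReal (Real.exp (β * (Kpot + Real.log 4)) * r ^ (-β)) *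
        volume (Metric.closedBall (0 : E2) 2) := by
        rw [setLIntegral_const]
        gcongr
        exact Set.sdiff_subset
    _ = _ := by
        rw [volume_closedBall_E2, ← ENNReal.ofReal_pow (by norm_num),
          ← ENNReal.ofReal_mul (by norm_num), ← ENNReal.ofReal_mul (by positivity), wgtC]
        congr 1; ring

lemma lintegral_exp_Ftil_le_mul (N : ℕ) {β lam r j : ℝ} (hβ : 0 ≤ β) (hl : 0 < lam)
    (hl2 : lam < 1 / 2) (hr : 0 < r) (hr2 : r ≤ 1 / 34) (hj : 0 < j)
    (hJ : ENNReal.ofReal j ≤ ∫⁻ z in Metric.closedBall 0 r, wgt β lam z) :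
    ∫⁻ P in confSet N, ENNReal.ofReal (Real.exp (-β * Ftil N lam P.1 P.2)) ≤
      (∫⁻ P in confSet N, bolt N β lam P) * ENNReal.ofReal
        (Real.exp (N * (34 * r + wgtC β * r ^ (-β) / j + 2 / Real.sqrt j))) := by
  set J := ∫⁻ z in Metric.closedBall 0 r, wgt β lam z with hJdef
  set I := ∫⁻ z in Metric.ball 0 2, wgt β lam z with hIdef
  have hIt : I < ⊤ := lintegral_wgt_lt_top hβ hl
  have hJI : J ≤ I := lintegral_mono_set (Metric.closedBall_subset_ball (by linarith))
  have hJt : J < ⊤ := hJI.trans_lt hIt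
  set a := J.toReal with ha
  set b := I.toReal with hb
  have hJa : J = ENNReal.ofReal a := (ENNReal.ofReal_toReal hJt.ne).symm
  have hIb : I = ENNReal.ofReal b := (ENNReal.ofReal_toReal hIt.ne).symm
  have hja : j ≤ a := (ENNReal.ofReal_le_iff_le_toReal hJt.ne).1 hJ
  have ha0 : 0 < a := hj.trans_le hja
  have hab : a ≤ b := ENNReal.toReal_mono hIt.ne hJI
  have hb0 : 0 < b := ha0.trans_le hab
  set T := wgtC β * r ^ (-β) with hT
  have hT0 : 0 ≤ T := mul_nonneg (wgtC_pos β).le (Real.rpow_nonneg hr.le _)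
  have hbT : b ≤ a + T := by
    have := lintegral_wgt_ball_le hβ hl hr
    rw [← hJdef, ← hIdef, hJa, hIb, ← ENNReal.ofReal_add ha0.le hT0] at this
    exact (ENNReal.ofReal_le_ofReal_iff (by positivity)).1 this
  have hbe : b ≤ a * Real.exp (T / j) := by
    have h1 : T / a ≤ T / j := by gcongr
    have h2 := (h1.trans (by linarith : T / j ≤ T / j + 1 - 1)).trans
      (sub_le_sub_right (Real.add_one_le_exp (T / j)) 1)
    have h3 : T ≤ (Real.exp (T / j) - 1) * a := (div_le_iff₀ ha0).1 h2
    linarith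
  have hZ : ENNReal.ofReal (N.factorial * (N * Real.exp (-(34 * r)) * a) ^ N) ≤
      ∫⁻ P in confSet N, bolt N β lam P := by
    refine le_trans ?_ (le_lintegral_bolt N hβ hl hr (by linarith))
    rw [ENNReal.ofReal_mul (Nat.cast_nonneg _), ENNReal.ofReal_natCast,
      ENNReal.ofReal_pow (by positivity), ENNReal.ofReal_mul (by positivity), ← hJdef, hJa]
    gcongr
    exact exp_mul_le_free N hr.le hr2
  refine (lintegral_exp_Ftil_le N hl hl2 hβ).trans (le_trans ?_ (mul_le_mul_left hZ _))
  rw [← ENNReal.ofReal_mul (by positivity), ← hIdef, hIb]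
  calc _ = ENNReal.ofReal ((N : ℝ) ^ N * ∑ m ∈ Finset.range (N + 1), (N.choose m : ℝ) *
        ((N.descFactorial m : ℝ) * ((N : ℝ) ^ (N - m) * b ^ m))) := by
        rw [Finset.mul_sum, ENNReal.ofReal_sum_of_nonneg fun m _ => by positivity]
        refine Finset.sum_congr rfl fun m _ => ?_
        rw [ENNReal.ofReal_mul (by positivity), ENNReal.ofReal_mul (by positivity),
          ENNReal.ofReal_mul (by positivity), ENNReal.ofReal_mul (by positivity),
          ENNReal.ofReal_pow (by positivity), ENNReal.ofReal_pow (by positivity),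
          ENNReal.ofReal_pow (by positivity), ENNReal.ofReal_natCast, ENNReal.ofReal_natCast,
          ENNReal.ofReal_natCast]
        ring
    _ ≤ _ := by
        apply ENNReal.ofReal_le_ofReal
        have e1 : Real.exp (N * (34 * r + T / j + 2 / Real.sqrt j)) =
            Real.exp (34 * r) ^ N * Real.exp (T / j) ^ N *
              Real.exp (2 * (N / Real.sqrt j)) := by
          rw [← Real.exp_nat_mul, ← Real.exp_nat_mul, ← Real.exp_add, ← Real.exp_add]
          congr 1; ring
        have e2 : Real.exp (-(34 * r)) ^ N * Real.exp (34 * r) ^ N = 1 := by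
          rw [← mul_pow, ← Real.exp_add, neg_add_cancel, Real.exp_zero, one_pow]
        calc _ ≤ (N : ℝ) ^ N * (N.factorial * (b ^ N * Real.exp (2 * (N / Real.sqrt b)))) := by
              gcongr
              exact sum_choose_descFactorial_le N hb0
          _ ≤ (N : ℝ) ^ N * (N.factorial * ((a * Real.exp (T / j)) ^ N *
                Real.exp (2 * (N / Real.sqrt j)))) := by
              have hjs := Real.sqrt_pos.2 hj
              have hjb := hja.trans hab
              gcongr
          _ = (N : ℝ) ^ N * (N.factorial * ((a * Real.exp (T / j)) ^ N *
                Real.exp (2 * (N / Real.sqrt j)))) *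
                (Real.exp (-(34 * r)) ^ N * Real.exp (34 * r) ^ N) := by rw [e2, mul_one]
          _ = _ := by
              rw [e1, mul_pow, mul_pow, mul_pow]; ring

lemma log_integral_Gibbs_le (N : ℕ) {β lam r j : ℝ} (hβ : 0 ≤ β) (hl : 0 < lam)
    (hl2 : lam < 1 / 2) (hr : 0 < r) (hr2 : r ≤ 1 / 34) (hj : 0 < j)
    (hJ : ENNReal.ofReal j ≤ ∫⁻ z in Metric.closedBall 0 r, wgt β lam z) :
    Real.log (∫ P, Real.exp (β * (Flam N lam P.1 P.2 - Ftil N lam P.1 P.2)) ∂(Gibbs N β lam)) ≤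
      N * (34 * r + wgtC β * r ^ (-β) / j + 2 / Real.sqrt j) := by
  set B := N * (34 * r + wgtC β * r ^ (-β) / j + 2 / Real.sqrt j) with hB
  have hB0 : 0 ≤ B := by
    have := wgtC_pos β
    positivity
  set x := ∫ P, Real.exp (β * (Flam N lam P.1 P.2 - Ftil N lam P.1 P.2)) ∂(Gibbs N β lam) with hx
  have hx0 : 0 ≤ x := integral_nonneg fun _ => (Real.exp_pos _).le
  have h1 : ENNReal.ofReal x ≤ ENNReal.ofReal (Real.exp B) := by
    refine (ofReal_integral_Gibbs_le N hβ hl).trans ?_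
    refine (mul_le_mul_right (lintegral_exp_Ftil_le_mul N hβ hl hl2 hr hr2 hj hJ) _).trans ?_
    rw [← mul_assoc]
    exact mul_le_of_le_one_left zero_le (ENNReal.inv_mul_le_one _)
  have h2 : x ≤ Real.exp B := (ENNReal.ofReal_le_ofReal_iff (Real.exp_pos _).le).1 h1
  rcases hx0.eq_or_lt with h | h
  · rw [← h, Real.log_zero]; exact hB0
  · exact (Real.log_le_iff_le_exp h).2 h2

/-! ### Lower bounds on the mass of short dipoles -/

lemma ofReal_le_wgt {β lam a : ℝ} (hβ : 0 ≤ β) (hl : 0 < lam) {z : E2} (hz : ‖z‖ + 2 * lam ≤ a) :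
    ENNReal.ofReal (a ^ (-β)) ≤ wgt β lam z := by
  have h0 : 0 < ‖z‖ + 2 * lam := by positivity
  apply ENNReal.ofReal_le_ofReal
  rw [Real.rpow_def_of_pos (h0.trans_le hz)]
  apply Real.exp_le_exp.2
  have h1 := le_gsm hl z
  have h2 := Real.log_le_log h0 hz
  have : β * -Real.log a ≤ β * gsm lam z := by gcongr; linarith
  linarith

lemma le_lintegral_wgt_rpow {β lam : ℝ} (hβ : 0 ≤ β) (hl : 0 < lam) :
    ENNReal.ofReal (3 ^ (-β) * Real.pi * lam ^ (2 - β)) ≤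
      ∫⁻ z in Metric.closedBall 0 lam, wgt β lam z := by
  calc _ = ENNReal.ofReal ((3 * lam) ^ (-β)) * volume (Metric.closedBall (0 : E2) lam) := by
        rw [volume_closedBall_E2, ← ENNReal.ofReal_pow hl.le, ← ENNReal.ofReal_mul (by positivity),
          ← ENNReal.ofReal_mul (by positivity), Real.mul_rpow (by norm_num) hl.le,
          sub_eq_add_neg, Real.rpow_add hl, Real.rpow_two]
        congr 1; ring
    _ = ∫⁻ _z in Metric.closedBall (0 : E2) lam, ENNReal.ofReal ((3 * lam) ^ (-β)) :=
        (setLIntegral_const _ _).symm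
    _ ≤ _ := by
        refine setLIntegral_mono (measurable_wgt β hl) fun z hz => ofReal_le_wgt hβ hl ?_
        have : ‖z‖ ≤ lam := by simpa using hz
        linarith

lemma le_lintegral_wgt_annulus {lam a : ℝ} (hl : 0 < lam) (ha : lam ≤ a) :
    ENNReal.ofReal (3 * Real.pi / 16) ≤
      ∫⁻ z in Metric.closedBall 0 (2 * a) \ Metric.closedBall 0 a, wgt 2 lam z := by
  have ha0 : 0 < a := hl.trans_le ha
  calc _ = ENNReal.ofReal ((4 * a) ^ (-2 : ℝ)) * ENNReal.ofReal (3 * Real.pi * a ^ 2) := by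
        rw [← ENNReal.ofReal_mul (by positivity), Real.rpow_neg (by positivity), Real.rpow_two]
        congr 1
        field_simp
        norm_num
    _ ≤ ENNReal.ofReal ((4 * a) ^ (-2 : ℝ)) *
          volume (Metric.closedBall (0 : E2) (2 * a) \ Metric.closedBall 0 a) := by
        gcongr
        refine le_trans (le_of_eq ?_) le_measure_sdiff
        rw [volume_closedBall_E2, volume_closedBall_E2, ← ENNReal.ofReal_pow (by positivity),
          ← ENNReal.ofReal_pow (by positivity), ← ENNReal.ofReal_mul (by positivity),
          ← ENNReal.ofReal_mul (by positivity), ← ENNReal.ofReal_sub _ (by positivity)]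
        congr 1; ring
    _ = ∫⁻ _z in Metric.closedBall (0 : E2) (2 * a) \ Metric.closedBall 0 a,
          ENNReal.ofReal ((4 * a) ^ (-2 : ℝ)) := (setLIntegral_const _ _).symm
    _ ≤ _ := by
        refine setLIntegral_mono (measurable_wgt 2 hl) fun z hz =>
          ofReal_le_wgt (by norm_num) hl ?_
        have : ‖z‖ ≤ 2 * a := by simpa using hz.1
        linarith

lemma le_lintegral_wgt_two {lam : ℝ} (hl : 0 < lam) (n : ℕ) :
    ENNReal.ofReal (n * (3 * Real.pi / 16)) ≤
      ∫⁻ z in Metric.closedBall 0 (2 ^ n * lam), wgt 2 lam z := by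
  induction n with
  | zero => simp
  | succ n ih =>
    have ha : lam ≤ 2 ^ n * lam := le_mul_of_one_le_left hl.le (one_le_pow₀ one_le_two)
    have hsub : Metric.closedBall (0 : E2) (2 ^ n * lam) ⊆
        Metric.closedBall 0 (2 * (2 ^ n * lam)) :=
      Metric.closedBall_subset_closedBall (by linarith)
    rw [show (2 : ℝ) ^ (n + 1) * lam = 2 * (2 ^ n * lam) by ring, ← Set.union_sdiff_cancel hsub,
      lintegral_union (measurableSet_closedBall.diff measurableSet_closedBall)
        Set.disjoint_sdiff_right,
      show ((n + 1 : ℕ) : ℝ) * (3 * Real.pi / 16) = n * (3 * Real.pi / 16) + 3 * Real.pi / 16 by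
        push_cast; ring, ENNReal.ofReal_add (by positivity) (by positivity)]
    exact add_le_add ih (le_lintegral_wgt_annulus hl ha)

/-! ### Asymptotics as the truncation length tends to zero -/

lemma eventually_wgt_two :
    ∀ᶠ lam in nhdsWithin (0 : ℝ) (Set.Ioi 0), ∃ L : ℝ, 1 ≤ L ∧
      L ^ (-(1 / (2 * 2)) : ℝ) ≤ 1 / 34 ∧ L ^ (-(1 / (2 * 2)) : ℝ) ≤ omegaL 2 lam ∧
      ENNReal.ofReal (3 * Real.pi / 64 * L) ≤
        ∫⁻ z in Metric.closedBall 0 (L ^ (-(1 / (2 * 2)) : ℝ)), wgt 2 lam z := by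
  have hlog : Filter.Tendsto (fun lam : ℝ => -Real.log lam) (nhdsWithin 0 (Set.Ioi 0))
      Filter.atTop := Filter.tendsto_neg_atBot_atTop.comp Real.tendsto_log_nhdsGT_zero
  have hr : Filter.Tendsto (fun lam : ℝ => (-Real.log lam) ^ (-(1 / (2 * 2)) : ℝ))
      (nhdsWithin 0 (Set.Ioi 0)) (nhds 0) :=
    (tendsto_rpow_neg_atTop (by norm_num)).comp hlog
  filter_upwards [hlog.eventually_ge_atTop 4, hr.eventually_le_const (by norm_num : (0 : ℝ) < 1 / 34),
    self_mem_nhdsWithin] with lam h4 hr2 hl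
  have hl : 0 < lam := hl
  set L := -Real.log lam with hL
  have hL0 : 0 < L := by linarith
  refine ⟨L, by linarith, hr2, ?_, ?_⟩
  · rw [omegaL, if_pos rfl, ← abs_neg, ← hL, abs_of_pos hL0]
    exact Real.rpow_le_rpow_of_exponent_le (by linarith) (by norm_num)
  · have hn1 : (⌊L / 2⌋₊ : ℝ) ≤ L / 2 := Nat.floor_le (by linarith)
    have hn2 : L / 2 < ⌊L / 2⌋₊ + 1 := Nat.lt_floor_add_one _
    refine le_trans (ENNReal.ofReal_le_ofReal ?_)
      ((le_lintegral_wgt_two hl ⌊L / 2⌋₊).trans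
        (lintegral_mono_set (Metric.closedBall_subset_closedBall ?_)))
    · nlinarith [Real.pi_pos]
    · have e1 : (2 : ℝ) ^ ⌊L / 2⌋₊ ≤ Real.exp (L / 2) := by
        calc (2 : ℝ) ^ ⌊L / 2⌋₊ ≤ Real.exp 1 ^ ⌊L / 2⌋₊ := by
              gcongr
              linarith [Real.add_one_le_exp 1]
          _ = Real.exp ⌊L / 2⌋₊ := by rw [← Real.exp_nat_mul, mul_one]
          _ ≤ _ := Real.exp_le_exp.2 hn1
      have e2 : lam = Real.exp (-L) := by rw [hL, neg_neg, Real.exp_log hl]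
      calc (2 : ℝ) ^ ⌊L / 2⌋₊ * lam ≤ Real.exp (L / 2) * Real.exp (-L) := by
            rw [← e2]; gcongr
        _ = Real.exp (-(L / 2)) := by rw [← Real.exp_add]; congr 1; ring
        _ ≤ _ := by
            rw [Real.rpow_def_of_pos hL0]
            apply Real.exp_le_exp.2
            linarith [Real.log_le_sub_one_of_pos hL0]

lemma rpow_le_omegaL {β lam : ℝ} (hβ : 2 < β) (hl : 0 < lam) (hl1 : 1 ≤ -Real.log lam) :
    lam ^ ((β - 2) / (2 * β)) ≤ omegaL β lam := by
  have h1 : lam ≤ 1 := by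
    by_contra! h
    linarith [Real.log_pos h]
  have hge : ∀ e : ℝ, e ≤ (β - 2) / (2 * β) → lam ^ ((β - 2) / (2 * β)) ≤ lam ^ e := fun e he =>
    Real.rpow_le_rpow_of_exponent_ge hl h1 he
  have h4 : 4 ≤ β → (1 : ℝ) / (2 + 36) ≤ (β - 2) / (2 * β) := by
    intro h
    rw [div_le_div_iff₀ (by norm_num) (by linarith)]
    linarith
  rw [omegaL, if_neg hβ.ne']
  split_ifs with h h'
  · apply hge
    rw [div_le_div_iff₀ (by linarith) (by linarith)]
    nlinarith
  · refine (hge _ (h4 (not_lt.1 h))).trans ?_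
    have : 1 ≤ |Real.log lam| := hl1.trans (neg_le_abs _)
    refine Real.rpow_le_rpow hl.le ?_ (by norm_num)
    exact le_mul_of_one_le_right hl.le this
  · exact hge _ (h4 (not_lt.1 h))

lemma eventually_wgt_of_two_lt {β : ℝ} (hβ : 2 < β) :
    ∀ᶠ lam in nhdsWithin (0 : ℝ) (Set.Ioi 0), ∃ L : ℝ, 1 ≤ L ∧
      L ^ (-(1 / (2 * β))) ≤ 1 / 34 ∧ L ^ (-(1 / (2 * β))) ≤ omegaL β lam ∧
      ENNReal.ofReal (3 ^ (-β) * Real.pi * L) ≤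
        ∫⁻ z in Metric.closedBall 0 (L ^ (-(1 / (2 * β)))), wgt β lam z := by
  have hlog : Filter.Tendsto (fun lam : ℝ => -Real.log lam) (nhdsWithin 0 (Set.Ioi 0))
      Filter.atTop := Filter.tendsto_neg_atBot_atTop.comp Real.tendsto_log_nhdsGT_zero
  have hs : 0 < (β - 2) / (2 * β) := div_pos (by linarith) (by linarith)
  have hr : Filter.Tendsto (fun lam : ℝ => lam ^ ((β - 2) / (2 * β)))
      (nhdsWithin 0 (Set.Ioi 0)) (nhds 0) := by
    have := (Real.continuousAt_rpow_const (0 : ℝ) ((β - 2) / (2 * β)) (Or.inr hs.le)).tendsto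
    rw [Real.zero_rpow hs.ne'] at this
    exact this.mono_left nhdsWithin_le_nhds
  filter_upwards [hlog.eventually_ge_atTop 1, hr.eventually_le_const (by norm_num : (0 : ℝ) < 1 / 34),
    self_mem_nhdsWithin] with lam h1 hr2 hl
  have hl : 0 < lam := hl
  have hl1 : lam ≤ 1 := by
    by_contra! h
    linarith [Real.log_pos h]
  have e : (lam ^ (2 - β)) ^ (-(1 / (2 * β))) = lam ^ ((β - 2) / (2 * β)) := by
    rw [← Real.rpow_mul hl.le]
    congr 1; ring
  refine ⟨lam ^ (2 - β), ?_, ?_, ?_, ?_⟩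
  · exact Real.one_le_rpow_of_pos_of_le_one_of_nonpos hl hl1 (by linarith)
  · rwa [e]
  · rw [e]; exact rpow_le_omegaL hβ hl h1
  · refine (le_lintegral_wgt_rpow (by linarith) hl).trans
      (lintegral_mono_set (Metric.closedBall_subset_closedBall ?_))
    rw [e]
    calc lam = lam ^ (1 : ℝ) := (Real.rpow_one lam).symm
      _ ≤ _ := Real.rpow_le_rpow_of_exponent_ge hl hl1
        ((div_le_one (by linarith)).2 (by linarith))

lemma exists_eventually_wgt {β : ℝ} (hβ : 2 ≤ β) :
    ∃ c : ℝ, 0 < c ∧ ∀ᶠ lam in nhdsWithin (0 : ℝ) (Set.Ioi 0), ∃ L : ℝ, 1 ≤ L ∧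
      L ^ (-(1 / (2 * β))) ≤ 1 / 34 ∧ L ^ (-(1 / (2 * β))) ≤ omegaL β lam ∧
      ENNReal.ofReal (c * L) ≤
        ∫⁻ z in Metric.closedBall 0 (L ^ (-(1 / (2 * β)))), wgt β lam z := by
  rcases hβ.eq_or_lt with rfl | h
  · exact ⟨3 * Real.pi / 64, by positivity, eventually_wgt_two⟩
  · exact ⟨3 ^ (-β) * Real.pi, by positivity, eventually_wgt_of_two_lt h⟩

lemma error_le {β c L : ℝ} (hβ : 2 ≤ β) (hc : 0 < c) (hL : 1 ≤ L) :
    34 * L ^ (-(1 / (2 * β))) + wgtC β * (L ^ (-(1 / (2 * β)))) ^ (-β) / (c * L) +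
      2 / Real.sqrt (c * L) ≤
    (34 + wgtC β / c + 2 / Real.sqrt c) * L ^ (-(1 / (2 * β))) := by
  have hL0 : 0 < L := by linarith
  have h1 : (L ^ (-(1 / (2 * β)))) ^ (-β) = Real.sqrt L := by
    rw [← Real.rpow_mul hL0.le, Real.sqrt_eq_rpow]
    congr 1
    field_simp
  have hs : 0 < Real.sqrt L := Real.sqrt_pos.2 hL0
  have h2 : 1 / Real.sqrt L ≤ L ^ (-(1 / (2 * β))) := by
    rw [Real.sqrt_eq_rpow, one_div, ← Real.rpow_neg hL0.le]
    refine Real.rpow_le_rpow_of_exponent_le hL (neg_le_neg ?_)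
    exact one_div_le_one_div_of_le (by norm_num) (by linarith)
  have h3 : wgtC β * Real.sqrt L / (c * L) = wgtC β / c * (1 / Real.sqrt L) := by
    have := Real.mul_self_sqrt hL0.le
    field_simp
    rw [sq, this]
  have h4 : 2 / Real.sqrt (c * L) = 2 / Real.sqrt c * (1 / Real.sqrt L) := by
    rw [Real.sqrt_mul hc.le]
    field_simp
  have hw := wgtC_pos β
  have h5 : wgtC β / c * (1 / Real.sqrt L) ≤ wgtC β / c * L ^ (-(1 / (2 * β))) := by gcongr
  have h6 : 2 / Real.sqrt c * (1 / Real.sqrt L) ≤ 2 / Real.sqrt c * L ^ (-(1 / (2 * β))) := by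
    gcongr
  rw [h1, h3, h4]
  linarith

/-- The energy essentially reduces to nearest-neighbor dipole interactions
(Theorem 1, item (2)). -/
theorem statement1 (β : ℝ) (hβ : 2 ≤ β) :
    ∃ C lam0 : ℝ, 0 < C ∧ 0 < lam0 ∧ lam0 < 1/2 ∧
      ∀ lam : ℝ, 0 < lam → lam < lam0 → ∀ N : ℕ, 2 ≤ N →
        Real.log (∫ P, Real.exp (β * (Flam N lam P.1 P.2 - Ftil N lam P.1 P.2))
            ∂(Gibbs N β lam)) ≤ C * (N * omegaL β lam + Real.log N) := by
  obtain ⟨c, hc, hev⟩ := exists_eventually_wgt hβ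
  obtain ⟨u, hu, hu2⟩ := mem_nhdsGT_iff_exists_Ioo_subset.1 hev
  have hw := wgtC_pos β
  refine ⟨34 + wgtC β / c + 2 / Real.sqrt c, min u (1 / 4), by positivity,
    lt_min hu (by norm_num), (min_le_right _ _).trans_lt (by norm_num), fun lam hl hl2 N hN => ?_⟩
  obtain ⟨L, hL, hr2, hω, hJ⟩ := hu2 ⟨hl, hl2.trans_le (min_le_left _ _)⟩
  have hL0 : 0 < L := by linarith
  have hlog : 0 ≤ Real.log N := Real.log_natCast_nonneg N
  have hω0 : 0 ≤ omegaL β lam := (Real.rpow_nonneg hL0.le _).trans hω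
  calc _ ≤ N * (34 * L ^ (-(1 / (2 * β))) +
        wgtC β * (L ^ (-(1 / (2 * β)))) ^ (-β) / (c * L) + 2 / Real.sqrt (c * L)) :=
        log_integral_Gibbs_le N (by linarith) hl
          (hl2.trans_le ((min_le_right _ _).trans (by norm_num)))
          (Real.rpow_pos_of_pos hL0 _) hr2 (mul_pos hc hL0) hJ
    _ ≤ N * ((34 + wgtC β / c + 2 / Real.sqrt c) * L ^ (-(1 / (2 * β)))) := by
        gcongr
        exact error_le hβ hc hL
    _ ≤ N * ((34 + wgtC β / c + 2 / Real.sqrt c) * omegaL β lam) := by gcongr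
    _ = (34 + wgtC β / c + 2 / Real.sqrt c) * (N * omegaL β lam) := by ring
    _ ≤ _ := by
        gcongr
        exact le_add_of_nonneg_right hlog
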